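/- For any N×N complex matrices A and B and any partition λ with at most N parts, ∫_{SU(N)} s_λ(U A U† B) dμ(U) = ∫_{U(N)} s_λ(U A U† B) d_*U = s_λ(A) s_λ(B) / s_λ(I_N). -/

import Mathlib

open scoped BigOperators Classical
open MeasureTheory Matrix

noncomputable section

/-- Complete homogeneous symmetric functions of the eigenvalues of `X`, defined through
Newton's identities from the power sums `p_m = Tr(X^m)`. -/
def hMat {N : ℕ} (X : Matrix (Fin N) (Fin N) ℂ) : ℕ → ℂ
  | 0 => 1
  | (k+1) => ((k : ℂ) + 1)⁻¹ *
      ∑ m ∈ Finset.range (k+1), (X ^ (m+1)).trace * hMat X (k - m)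
  termination_by k => k
  decreasing_by exact Nat.lt_succ_of_le (Nat.sub_le _ _)

def hMatZ {N : ℕ} (X : Matrix (Fin N) (Fin N) ℂ) (k : ℤ) : ℂ :=
  if k < 0 then 0 else hMat X k.toNat

/-- The Schur polynomial `s_λ(X)` of an `N×N` complex matrix `X`, evaluated at the
eigenvalues of `X`, via the Jacobi-Trudi formula `s_λ = det(h_{λ_i - i + j})`.
Here `l : Fin N → ℕ` lists the (at most `N`) parts of the partition `λ`. -/
def schur {N : ℕ} (l : Fin N → ℕ) (X : Matrix (Fin N) (Fin N) ℂ) : ℂ :=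
  (Matrix.of fun i j : Fin N => hMatZ X ((l i : ℤ) - (i : ℤ) + (j : ℤ))).det

/-- Partitions with at most `N` parts (weakly decreasing functions `Fin N → ℕ`). -/
def PartitionN (N : ℕ) := {l : Fin N → ℕ // Antitone l}

/-- The unitary group `U(N)`. -/
abbrev UN (N : ℕ) := Matrix.unitaryGroup (Fin N) ℂ

instance (N : ℕ) : MeasurableSpace (UN N) := borel _

/-- The special unitary group `SU(N)`, as a subgroup of `U(N)`. -/
def SUN (N : ℕ) : Subgroup (UN N) where
  carrier := {U | (U : Matrix (Fin N) (Fin N) ℂ).det = 1}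
  one_mem' := by simp
  mul_mem' := by
    intro a b ha hb
    simp only [Set.mem_setOf_eq, Submonoid.coe_mul, Matrix.det_mul] at *
    rw [ha, hb, mul_one]
  inv_mem' := by
    intro a ha
    simp only [Set.mem_setOf_eq] at *
    have h1 : ((a⁻¹ : UN N) : Matrix (Fin N) (Fin N) ℂ)
        = star (a : Matrix (Fin N) (Fin N) ℂ) := rfl
    have h2 : (star (a : Matrix (Fin N) (Fin N) ℂ)).det
        = star ((a : Matrix (Fin N) (Fin N) ℂ)).det := by
      simp [Matrix.star_eq_conjTranspose, Matrix.det_conjTranspose]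
    rw [h1, h2, ha, star_one]

instance (N : ℕ) : MeasurableSpace (SUN N) := borel _


section MatrixPolynomials

open MvPolynomial

/-- The value at a matrix `X` of a polynomial in the matrix entries. -/
def matEval {N : ℕ} {R : Type*} [CommRing R] [Algebra ℂ R] (X : Matrix (Fin N) (Fin N) R) :
    MvPolynomial (Fin N × Fin N) ℂ →ₐ[ℂ] R :=
  aeval fun ij => X ij.1 ij.2

section Density

variable {N : ℕ}

lemma matEval_X {R : Type*} [CommRing R] [Algebra ℂ R] (X : Matrix (Fin N) (Fin N) R)
    (i j : Fin N) : matEval X (MvPolynomial.X (i, j)) = X i j := by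
  simp [matEval]

lemma map_matEval {R S : Type*} [CommRing R] [Algebra ℂ R] [CommRing S] [Algebra ℂ S]
    (f : R →ₐ[ℂ] S) (X : Matrix (Fin N) (Fin N) R) (p : MvPolynomial (Fin N × Fin N) ℂ) :
    f (matEval X p) = matEval (X.map f) p := by
  rw [matEval, ← AlgHom.comp_apply, comp_aeval]
  rfl

lemma matEval_funext {p q : MvPolynomial (Fin N × Fin N) ℂ}
    (h : ∀ X : Matrix (Fin N) (Fin N) ℂ, matEval X p = matEval X q) : p = q := by
  refine MvPolynomial.funext fun x => ?_
  simpa [matEval, aeval_eq_eval] using h (Matrix.of fun i j => x (i, j))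

lemma infinite_unit_circle : {z : ℂ | ‖z‖ = 1}.Infinite := by
  have h : Infinite (Set.Ioc (-Real.pi) Real.pi) :=
    (Set.Ioc_infinite (by linarith [Real.pi_pos])).to_subtype
  have : Infinite Circle := Circle.argEquiv.symm.injective |> Infinite.of_injective _
  refine (Set.infinite_range_of_injective (α := Circle) (f := fun z => (z : ℂ))
    fun _ _ h => Circle.ext h).mono ?_
  rintro _ ⟨z, rfl⟩
  exact Circle.norm_coe z

lemma eq_zero_of_eval_torus {p : MvPolynomial (Fin N) ℂ}
    (h : ∀ t : Fin N → ℂ, (∀ i, ‖t i‖ = 1) → eval t p = 0) : p = 0 :=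
  funext_set (fun _ => {z : ℂ | ‖z‖ = 1}) (fun _ => infinite_unit_circle) fun x hx => by
    rw [h x fun i => hx i trivial, map_zero]

/-- Hermitian matrices are Zariski dense. -/
lemma matEval_eq_zero_of_isHermitian {p : MvPolynomial (Fin N × Fin N) ℂ}
    (h : ∀ X : Matrix (Fin N) (Fin N) ℂ, X.IsHermitian → matEval X p = 0) : p = 0 := by
  refine matEval_funext fun X => ?_
  rw [map_zero]
  let H : Matrix (Fin N) (Fin N) ℂ := (1 / 2 : ℂ) • (X + star X)
  let K : Matrix (Fin N) (Fin N) ℂ := (Complex.I / 2) • (star X - X)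
  have hH : H.IsHermitian := by
    ext i j
    simp [H, add_comm]
  have hK : K.IsHermitian := by
    ext i j
    simp [K]
    ring
  let Z : Matrix (Fin N) (Fin N) (Polynomial ℂ) :=
    H.map Polynomial.C + (Polynomial.X : Polynomial ℂ) • K.map Polynomial.C
  have hZ : ∀ t : ℂ, Polynomial.eval t (matEval Z p) = matEval (H + t • K) p := by
    intro t
    have := map_matEval (Polynomial.aeval t) Z p
    rw [Polynomial.coe_aeval_eq_eval] at this
    rw [this]
    congr 2
    ext i j
    simp [Z]
    exact mul_comm _ _
  have h0 : matEval Z p = 0 := by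
    refine Polynomial.eq_zero_of_infinite_isRoot _ ?_
    refine (Set.infinite_range_of_injective Complex.ofReal_injective).mono ?_
    rintro _ ⟨t, rfl⟩
    change Polynomial.eval _ _ = 0
    rw [hZ]
    refine h _ (hH.add ?_)
    ext i j
    have := congrFun (congrFun hK i) j
    simp only [conjTranspose_apply] at this
    simp [this]
  have hX : X = H + Complex.I • K := by
    ext i j
    simp only [H, K, Matrix.add_apply, Matrix.smul_apply, Matrix.sub_apply, Matrix.star_apply,
      smul_eq_mul, RCLike.star_def]
    linear_combination (1 / 2 : ℂ) * (X i j - (starRingEnd ℂ) (X j i)) * Complex.I_sq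
  rw [hX, ← hZ, h0, Polynomial.eval_zero]

lemma exists_unitary_diagonal {X : Matrix (Fin N) (Fin N) ℂ} (hX : X.IsHermitian) :
    ∃ (U : UN N) (d : Fin N → ℂ),
      X = (U : Matrix (Fin N) (Fin N) ℂ) * diagonal d * star (U : Matrix (Fin N) (Fin N) ℂ) := by
  refine ⟨hX.eigenvectorUnitary, RCLike.ofReal ∘ hX.eigenvalues, ?_⟩
  conv_lhs => rw [hX.spectral_theorem]
  rw [Unitary.conjStarAlgAut_apply]

/-- The diagonal unitary matrix with given unimodular entries. -/
def diagUnitary (t : Fin N → ℂ) (ht : ∀ i, ‖t i‖ = 1) : UN N :=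
  ⟨diagonal t, by
    rw [mem_unitaryGroup_iff, star_eq_conjTranspose, diagonal_conjTranspose, diagonal_mul_diagonal,
      ← diagonal_one]
    congr 1
    ext i
    simp [Complex.mul_conj, Complex.normSq_eq_norm_sq, ht i]⟩

/-- The unitary group is Zariski dense. -/
lemma matEval_eq_zero_of_unitary {p : MvPolynomial (Fin N × Fin N) ℂ}
    (h : ∀ U : UN N, matEval (U : Matrix (Fin N) (Fin N) ℂ) p = 0) : p = 0 := by
  refine matEval_eq_zero_of_isHermitian fun X hX => ?_
  obtain ⟨U, d, rfl⟩ := exists_unitary_diagonal hX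
  let W : Matrix (Fin N) (Fin N) ℂ := U
  let Z : Matrix (Fin N) (Fin N) (MvPolynomial (Fin N) ℂ) :=
    W.map C * diagonal MvPolynomial.X * (star W).map C
  have hZ : ∀ t : Fin N → ℂ, eval t (matEval Z p) = matEval (W * diagonal t * star W) p := by
    intro t
    have := map_matEval (aeval t) Z p
    refine this.trans ?_
    congr 2
    ext i j
    simp [Z, Matrix.mul_apply, diagonal_apply]
  have h0 : matEval Z p = 0 := by
    refine eq_zero_of_eval_torus fun t ht => ?_
    rw [hZ]
    exact h (U * diagUnitary t ht * star U)
  change matEval (W * diagonal d * star W) p = 0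
  rw [← hZ, h0, map_zero]

/-- A polynomial in the matrix entries which is invariant under unitary conjugation. -/
def IsClassPoly (p : MvPolynomial (Fin N × Fin N) ℂ) : Prop :=
  ∀ (U : UN N) (X : Matrix (Fin N) (Fin N) ℂ),
    matEval ((U : Matrix (Fin N) (Fin N) ℂ) * X * star (U : Matrix (Fin N) (Fin N) ℂ)) p
      = matEval X p

lemma IsClassPoly.sub {p q : MvPolynomial (Fin N × Fin N) ℂ} (hp : IsClassPoly p)
    (hq : IsClassPoly q) : IsClassPoly (p - q) := fun U X => by
  rw [map_sub, map_sub, hp U X, hq U X]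

lemma IsClassPoly.smul {p : MvPolynomial (Fin N × Fin N) ℂ} (hp : IsClassPoly p) (c : ℂ) :
    IsClassPoly (c • p) := fun U X => by
  rw [map_smul, map_smul, hp U X]

/-- A class polynomial is determined by its values on diagonal matrices. -/
lemma IsClassPoly.eq_of_diagonal {p q : MvPolynomial (Fin N × Fin N) ℂ} (hp : IsClassPoly p)
    (hq : IsClassPoly q) (h : ∀ d : Fin N → ℂ, matEval (diagonal d) p = matEval (diagonal d) q) :
    p = q := by
  rw [← sub_eq_zero]
  refine matEval_eq_zero_of_isHermitian fun X hX => ?_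
  obtain ⟨U, d, rfl⟩ := exists_unitary_diagonal hX
  rw [hp.sub hq U, map_sub, h, sub_self]

lemma star_mul_coe (U : UN N) :
    star (U : Matrix (Fin N) (Fin N) ℂ) * (U : Matrix (Fin N) (Fin N) ℂ) = 1 := U.2.1

lemma coe_mul_star (U : UN N) :
    (U : Matrix (Fin N) (Fin N) ℂ) * star (U : Matrix (Fin N) (Fin N) ℂ) = 1 := U.2.2

lemma isClassPoly_of_mul_comm {p : MvPolynomial (Fin N × Fin N) ℂ}
    (h : ∀ X Y : Matrix (Fin N) (Fin N) ℂ, matEval (X * Y) p = matEval (Y * X) p) :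
    IsClassPoly p := fun U X => by
  rw [h, ← mul_assoc, star_mul_coe, one_mul]

/-- Class polynomials are invariant under cyclic permutation of a product. -/
lemma IsClassPoly.mul_comm {p : MvPolynomial (Fin N × Fin N) ℂ} (hp : IsClassPoly p)
    (X Y : Matrix (Fin N) (Fin N) ℂ) : matEval (X * Y) p = matEval (Y * X) p := by
  let G : Matrix (Fin N) (Fin N) (MvPolynomial (Fin N × Fin N) ℂ) :=
    Matrix.of fun i j => MvPolynomial.X (i, j)
  have hG : ∀ Y : Matrix (Fin N) (Fin N) ℂ, G.map (matEval Y) = Y := fun Y => by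
    ext i j
    simp [G, matEval_X]
  have hC : ∀ Y : Matrix (Fin N) (Fin N) ℂ, (X.map C).map (matEval Y) = X := fun Y => by
    ext i j
    simp [matEval]
  have key : matEval (X.map C * G) p - matEval (G * X.map C) p = 0 := by
    refine matEval_eq_zero_of_unitary fun U => ?_
    rw [map_sub, map_matEval, map_matEval, Matrix.map_mul, Matrix.map_mul, hG, hC,
      ← hp U (X * U), mul_assoc, mul_assoc, coe_mul_star, mul_one, sub_self]
  have := congrArg (matEval Y) key
  rwa [map_sub, map_matEval, map_matEval, Matrix.map_mul, Matrix.map_mul, hG, hC, map_zero,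
    sub_eq_zero] at this

end Density

section PrincipalMinors

variable {N : ℕ} {R : Type*} [CommRing R]

/-- The principal minor of `X` with rows and columns in `S`, as a determinant of full size. -/
def principalMinor (S : Finset (Fin N)) (X : Matrix (Fin N) (Fin N) R) : R :=
  (Matrix.of fun i j => if i ∈ S then X i j else (1 : Matrix (Fin N) (Fin N) R) i j).det

/-- The sum of the principal minors of size `k`. -/
def esymmMat (k : ℕ) (X : Matrix (Fin N) (Fin N) R) : R :=
  ∑ S ∈ Finset.powersetCard k Finset.univ, principalMinor S X

lemma principalMinor_diagonal_mul (S : Finset (Fin N)) (t : Fin N → R)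
    (Y : Matrix (Fin N) (Fin N) R) :
    principalMinor S (diagonal t * Y) = (∏ i ∈ S, t i) * principalMinor S Y := by
  rw [principalMinor, principalMinor, ← Finset.prod_ite_mem_eq S t, ← det_mul_column]
  congr 1
  ext i j
  simp only [of_apply, diagonal_mul]
  split_ifs <;> simp

lemma principalMinor_one (S : Finset (Fin N)) :
    principalMinor S (1 : Matrix (Fin N) (Fin N) R) = 1 := by
  rw [principalMinor]
  convert det_one (n := Fin N) (R := R)
  ext i j
  simp

lemma principalMinor_diagonal (S : Finset (Fin N)) (t : Fin N → R) :
    principalMinor S (diagonal t) = ∏ i ∈ S, t i := by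
  rw [← mul_one (diagonal t), principalMinor_diagonal_mul, principalMinor_one, mul_one]

lemma map_principalMinor {R' : Type*} [CommRing R'] (f : R →+* R') (S : Finset (Fin N))
    (X : Matrix (Fin N) (Fin N) R) : f (principalMinor S X) = principalMinor S (X.map f) := by
  rw [principalMinor, principalMinor, RingHom.map_det]
  congr 1
  ext i j
  simp only [RingHom.mapMatrix_apply, map_apply, of_apply, one_apply]
  split_ifs <;> simp

lemma map_esymmMat {R' : Type*} [CommRing R'] (f : R →+* R') (k : ℕ)
    (X : Matrix (Fin N) (Fin N) R) : f (esymmMat k X) = esymmMat k (X.map f) := by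
  simp_rw [esymmMat, map_sum, map_principalMinor]

lemma det_one_add_smul_eq_sum (z : R) (X : Matrix (Fin N) (Fin N) R) :
    (1 + z • X).det = ∑ S : Finset (Fin N), z ^ S.card * principalMinor S X := by
  rw [add_comm]
  have h := (detRowAlternating (n := Fin N) (R := R)).toMultilinearMap.map_add_univ
    (fun i => (z • X) i) (fun i => (1 : Matrix (Fin N) (Fin N) R) i)
  refine h.trans (Finset.sum_congr rfl fun S _ => ?_)
  rw [← Finset.prod_const, ← Finset.prod_ite_mem_eq S fun _ => z, principalMinor,
    ← det_mul_column]
  change det _ = _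
  congr 1
  ext i j
  simp only [of_apply, Finset.piecewise]
  split_ifs <;> simp

lemma esymmMat_mul_comm (k : ℕ) (A B : Matrix (Fin N) (Fin N) R) :
    esymmMat k (A * B) = esymmMat k (B * A) := by
  have key : ∀ M : Matrix (Fin N) (Fin N) R, esymmMat k M =
      (1 + (Polynomial.X : Polynomial R) • M.map Polynomial.C).det.coeff k := fun M => by
    rw [det_one_add_smul_eq_sum, Polynomial.finsetSum_coeff, esymmMat,
      ← Finset.univ_filter_card_eq, Finset.sum_filter]
    refine Finset.sum_congr rfl fun S _ => ?_
    rw [← map_principalMinor, Polynomial.coeff_X_pow_mul', Polynomial.coeff_C]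
    by_cases h : S.card = k
    · simp [h]
    · rw [if_neg h]
      split_ifs <;> first | rfl | omega
  rw [key, key, Matrix.map_mul, Matrix.map_mul, ← smul_mul, det_one_add_mul_comm, Matrix.mul_smul]

lemma esymmMat_diagonal (k : ℕ) (t : Fin N → R) :
    esymmMat k (diagonal t) = ∑ S ∈ Finset.powersetCard k Finset.univ, ∏ i ∈ S, t i := by
  simp_rw [esymmMat, principalMinor_diagonal]

/-- The generic matrix. -/
def genMat (N : ℕ) : Matrix (Fin N) (Fin N) (MvPolynomial (Fin N × Fin N) ℂ) :=
  Matrix.of fun i j => MvPolynomial.X (i, j)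

lemma genMat_map {R : Type*} [CommRing R] [Algebra ℂ R] (X : Matrix (Fin N) (Fin N) R) :
    (genMat N).map (matEval X) = X := by
  ext i j
  simp [genMat, matEval_X]

lemma matEval_esymmMat {R : Type*} [CommRing R] [Algebra ℂ R] (X : Matrix (Fin N) (Fin N) R)
    (k : ℕ) : matEval X (esymmMat k (genMat N)) = esymmMat k X := by
  conv_rhs => rw [← genMat_map X]
  exact map_esymmMat (matEval X : _ →+* R) k (genMat N)

end PrincipalMinors

section LexSupport

variable {N : ℕ} {R : Type*} [CommRing R]

/-- All exponents of `f` lie in `D`. -/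
def SuppIn (D : Set (Lex (Fin N →₀ ℕ))) (f : MvPolynomial (Fin N) R) : Prop :=
  ∀ m, coeff m f ≠ 0 → toLex m ∈ D

lemma SuppIn.mono {D E : Set (Lex (Fin N →₀ ℕ))} {f : MvPolynomial (Fin N) R} (h : SuppIn D f)
    (hDE : D ⊆ E) : SuppIn E f := fun m hm => hDE (h m hm)

lemma SuppIn.zero {D : Set (Lex (Fin N →₀ ℕ))} : SuppIn D (0 : MvPolynomial (Fin N) R) :=
  fun m hm => absurd (coeff_zero m) hm

lemma SuppIn.add {D : Set (Lex (Fin N →₀ ℕ))} {f g : MvPolynomial (Fin N) R} (hf : SuppIn D f)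
    (hg : SuppIn D g) : SuppIn D (f + g) := fun m hm => by
  by_cases h : coeff m f = 0
  · exact hg m fun h' => hm (by rw [coeff_add, h, h', add_zero])
  · exact hf m h

lemma SuppIn.sum {ι : Type*} {D : Set (Lex (Fin N →₀ ℕ))} {f : ι → MvPolynomial (Fin N) R}
    {s : Finset ι} (hf : ∀ i ∈ s, SuppIn D (f i)) : SuppIn D (∑ i ∈ s, f i) :=
  Finset.sum_induction f (SuppIn D) (fun _ _ => SuppIn.add) SuppIn.zero hf

lemma SuppIn.mul {a b : Lex (Fin N →₀ ℕ)} {f g : MvPolynomial (Fin N) R}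
    (hf : SuppIn (Set.Iic a) f) (hg : SuppIn (Set.Iic b) g) : SuppIn (Set.Iic (a + b)) (f * g) := by
  intro m hm
  rw [coeff_mul] at hm
  obtain ⟨⟨i, j⟩, hij, h⟩ := Finset.exists_ne_zero_of_sum_ne_zero hm
  rw [Finset.HasAntidiagonal.mem_antidiagonal] at hij
  rw [← hij, toLex_add]
  exact Set.mem_Iic.2 (add_le_add (Set.mem_Iic.1 (hf i (left_ne_zero_of_mul h)))
    (Set.mem_Iic.1 (hg j (right_ne_zero_of_mul h))))

lemma SuppIn.C (r : R) : SuppIn (Set.Iic (0 : Lex (Fin N →₀ ℕ))) (C r) := by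
  intro m hm
  rw [coeff_C] at hm
  rw [← (ite_ne_right_iff.1 hm).1]
  exact Set.mem_Iic.2 (le_refl (0 : Lex (Fin N →₀ ℕ)))

lemma SuppIn.C_mul {a : Lex (Fin N →₀ ℕ)} {f : MvPolynomial (Fin N) R}
    (hf : SuppIn (Set.Iic a) f) (r : R) : SuppIn (Set.Iic a) (MvPolynomial.C r * f) := by
  simpa using (SuppIn.C r).mul hf

lemma SuppIn.pow {a : Lex (Fin N →₀ ℕ)} {f : MvPolynomial (Fin N) R}
    (hf : SuppIn (Set.Iic a) f) (n : ℕ) : SuppIn (Set.Iic (n • a)) (f ^ n) := by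
  induction n with
  | zero => simpa using SuppIn.C (N := N) (1 : R)
  | succ n ih => rw [pow_succ, succ_nsmul]; exact ih.mul hf

lemma SuppIn.prod {ι : Type*} {s : Finset ι} {a : ι → Lex (Fin N →₀ ℕ)}
    {f : ι → MvPolynomial (Fin N) R} (hf : ∀ i ∈ s, SuppIn (Set.Iic (a i)) (f i)) :
    SuppIn (Set.Iic (∑ i ∈ s, a i)) (∏ i ∈ s, f i) := by
  induction s using Finset.induction_on with
  | empty => simpa using SuppIn.C (N := N) (1 : R)
  | insert i s hi ih =>
    rw [Finset.sum_insert hi, Finset.prod_insert hi]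
    exact (hf i (Finset.mem_insert_self i s)).mul
      (ih fun j hj => hf j (Finset.mem_insert_of_mem hj))

end LexSupport

section Triangularity

variable {N : ℕ}

/-- The restriction to diagonal matrices of a polynomial in the matrix entries. -/
def diagPoly (g : MvPolynomial (Fin N × Fin N) ℂ) : MvPolynomial (Fin N) ℂ :=
  matEval (diagonal MvPolynomial.X) g

lemma eval_diagPoly (g : MvPolynomial (Fin N × Fin N) ℂ) (x : Fin N → ℂ) :
    eval x (diagPoly g) = matEval (diagonal x) g := by
  refine (map_matEval (aeval x) _ g).trans ?_
  congr 2
  ext i j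
  rw [map_apply, diagonal_apply, diagonal_apply]
  split_ifs <;> simp

lemma IsClassPoly.diagPoly_isSymmetric {g : MvPolynomial (Fin N × Fin N) ℂ}
    (hg : IsClassPoly g) : (diagPoly g).IsSymmetric := fun σ => by
  refine MvPolynomial.funext fun x => ?_
  rw [eval_rename, eval_diagPoly, eval_diagPoly]
  have h1 : diagonal (x ∘ σ) = (1 : Matrix (Fin N) (Fin N) ℂ).submatrix σ id *
      (diagonal x * (1 : Matrix (Fin N) (Fin N) ℂ).submatrix id σ) := by
    ext i j
    simp [Matrix.mul_apply, diagonal_apply, one_apply]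
    split_ifs with h
    · rw [h]
    · rfl
  have h2 : (1 : Matrix (Fin N) (Fin N) ℂ).submatrix id σ *
      (1 : Matrix (Fin N) (Fin N) ℂ).submatrix σ id = 1 := by
    rw [submatrix_mul_equiv]
    simp
  rw [h1, hg.mul_comm, mul_assoc, h2, mul_one]

lemma matEval_aeval_esymmMat {R : Type*} [CommRing R] [Algebra ℂ R]
    (X : Matrix (Fin N) (Fin N) R) (P : MvPolynomial (Fin N) ℂ) :
    matEval X (aeval (fun k : Fin N => esymmMat (k + 1) (genMat N)) P) =
      aeval (fun k : Fin N => esymmMat (k + 1) X) P := by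
  rw [← AlgHom.comp_apply, comp_aeval]
  simp_rw [matEval_esymmMat]

lemma isClassPoly_aeval_esymmMat (P : MvPolynomial (Fin N) ℂ) :
    IsClassPoly (aeval (fun k : Fin N => esymmMat (k + 1) (genMat N)) P) :=
  isClassPoly_of_mul_comm fun X Y => by
    rw [matEval_aeval_esymmMat, matEval_aeval_esymmMat]
    simp_rw [esymmMat_mul_comm _ X Y]

/-- The highest exponent of a monomial in the elementary symmetric polynomials. -/
def accLex (t : Fin N →₀ ℕ) : Lex (Fin N →₀ ℕ) :=
  toLex (Finsupp.equivFunOnFinite.symm (Fin.accumulate N N t))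

lemma accLex_eq_sum (t : Fin N →₀ ℕ) :
    accLex t = ∑ i, t i • accLex (Finsupp.single i 1) := by
  have h : ∀ f : Fin N → Lex (Fin N →₀ ℕ), ofLex (∑ i, f i) = ∑ i, ofLex (f i) := fun f =>
    map_sum (⟨⟨ofLex, rfl⟩, fun _ _ => rfl⟩ : Lex (Fin N →₀ ℕ) →+ (Fin N →₀ ℕ)) f Finset.univ
  have h' : ∀ i, ofLex (t i • accLex (Finsupp.single i 1)) =
      t i • ofLex (accLex (Finsupp.single i 1)) := fun i => rfl
  rw [← ofLex_inj, h]
  simp_rw [h']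
  ext j
  simp [accLex, Finset.sum_filter, Finsupp.single_apply]

lemma accLex_injective : Function.Injective (accLex (N := N)) := fun s t h => by
  have h1 := Finsupp.equivFunOnFinite.symm.injective (toLex.injective h)
  exact DFunLike.ext' (Fin.accumulate_injective le_rfl h1)

lemma toLex_le_accLex {S : Finset (Fin N)} {k : Fin N} (hS : S.card = k + 1) :
    toLex (∑ i ∈ S, Finsupp.single i 1) ≤ accLex (Finsupp.single k 1) := by
  have h1 : AddMonoidAlgebra.supDegree toLex (esymm (Fin N) ℂ (k + 1)) =
      accLex (Finsupp.single k 1) := by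
    rw [← ofLex_inj, DFunLike.ext'_iff, supDegree_esymm k.2]
    rfl
  rw [← h1]
  refine Finset.le_sup (f := toLex) (s := (esymm (Fin N) ℂ (k + 1)).support) ?_
  rw [support_esymm]
  exact Finset.mem_image.2 ⟨S, by simp [hS], rfl⟩

variable {R : Type*} [CommRing R] [Algebra ℂ R]

omit [Algebra ℂ R] in
lemma suppIn_esymmMat (Y : Matrix (Fin N) (Fin N) R) (k : Fin N) :
    SuppIn (Set.Iic (accLex (Finsupp.single k 1)))
      (esymmMat (k + 1) (diagonal MvPolynomial.X * Y.map C)) := by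
  refine SuppIn.sum fun S hS => ?_
  rw [principalMinor_diagonal_mul, ← map_principalMinor, mul_comm]
  refine SuppIn.C_mul (fun m hm => ?_) _
  have h : ∏ i ∈ S, (X i : MvPolynomial (Fin N) R) =
      monomial (∑ i ∈ S, Finsupp.single i 1) 1 := by
    rw [monomial_sum_one]
    rfl
  rw [h, coeff_monomial] at hm
  rw [← (ite_ne_right_iff.1 hm).1]
  exact Set.mem_Iic.2 (toLex_le_accLex (Finset.mem_powersetCard.1 hS).2)

/-- The exponents in `t` of a class polynomial at `diag(t) Y` are dominated by those of its
restriction to diagonal matrices. -/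
lemma IsClassPoly.suppIn {g : MvPolynomial (Fin N × Fin N) ℂ} (hg : IsClassPoly g)
    {D : Set (Lex (Fin N →₀ ℕ))} (hD : IsLowerSet D) (h : SuppIn D (diagPoly g))
    (Y : Matrix (Fin N) (Fin N) R) :
    SuppIn D (matEval (diagonal MvPolynomial.X * Y.map C : Matrix _ _ (MvPolynomial (Fin N) R)) g)
    := by
  obtain ⟨P, hP⟩ := (esymmAlgHom_fin_bijective ℂ N).2 ⟨diagPoly g, hg.diagPoly_isSymmetric⟩
  have hP1 : diagPoly g = aeval (fun i : Fin N => esymm (Fin N) ℂ (i + 1)) P := by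
    rw [← esymmAlgHom_apply, hP]
  have hgP : g = aeval (fun k : Fin N => esymmMat (k + 1) (genMat N)) P := by
    refine hg.eq_of_diagonal (isClassPoly_aeval_esymmMat P) fun d => ?_
    rw [← eval_diagPoly, ← eval_diagPoly, hP1, diagPoly, matEval_aeval_esymmMat]
    simp_rw [esymmMat_diagonal, esymm]
  rw [hgP, matEval_aeval_esymmMat, aeval_def, eval₂_eq']
  refine SuppIn.sum fun m hm => ?_
  have hmD : accLex m ∈ D := by
    obtain ⟨m₀, hm₀, hmax⟩ := Finset.exists_max_image P.support accLex ⟨m, hm⟩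
    refine hD (hmax m hm) ?_
    have hsum : diagPoly g = ∑ t ∈ P.support, esymmAlgHomMonomial (Fin N) t (coeff t P) := by
      conv_lhs => rw [hP1, P.as_sum, map_sum]
      simp_rw [esymmAlgHomMonomial, esymmAlgHom_apply]
    have hdeg : ∀ t ∈ P.support, AddMonoidAlgebra.supDegree toLex
        (esymmAlgHomMonomial (Fin N) t (coeff t P)) = accLex t := fun t ht => by
      rw [← ofLex_inj, DFunLike.ext'_iff,
        supDegree_esymmAlgHomMonomial (mem_support_iff.1 ht) t le_rfl]
      rfl
    have hlead := AddMonoidAlgebra.supDegree_leadingCoeff_sum_eq (D := toLex)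
      (f := fun t => esymmAlgHomMonomial (Fin N) t (coeff t P)) hm₀ fun t ht hne => by
        rw [hdeg t ht, hdeg m₀ hm₀]
        exact lt_of_le_of_ne (hmax t ht) fun h' => hne (accLex_injective h')
    have hne : diagPoly g ≠ 0 := by
      rw [hsum, Ne, ← AddMonoidAlgebra.leadingCoeff_eq_zero toLex.injective, hlead.2,
        leadingCoeff_esymmAlgHomMonomial _ le_rfl]
      exact mem_support_iff.1 hm₀
    obtain ⟨a, ha, hae⟩ := AddMonoidAlgebra.exists_supDegree_mem_support toLex hne
    have h2 : accLex m₀ = toLex a := by rw [← hdeg m₀ hm₀, ← hlead.1, ← hsum, hae]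
    rw [h2]
    exact h a (mem_support_iff.1 ha)
  refine SuppIn.mono ?_ (hD.Iic_subset hmD)
  rw [accLex_eq_sum]
  exact SuppIn.C_mul (SuppIn.prod fun i _ => (suppIn_esymmMat Y i).pow _) _

end Triangularity

section CoefficientFunctional

variable {σ W : Type*} [CommRing W] [Algebra ℂ W]

/-- Applying a linear functional to the coefficients of a polynomial. -/
def mapFunctional (φ : W →ₗ[ℂ] ℂ) (F : MvPolynomial σ W) : MvPolynomial σ ℂ :=
  ∑ m ∈ F.support, monomial m (φ (coeff m F))

lemma coeff_mapFunctional (φ : W →ₗ[ℂ] ℂ) (F : MvPolynomial σ W) (m : σ →₀ ℕ) :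
    coeff m (mapFunctional φ F) = φ (coeff m F) := by
  rw [mapFunctional, coeff_sum]
  simp_rw [coeff_monomial]
  rw [Finset.sum_ite_eq' F.support m]
  split_ifs with h
  · rfl
  · rw [notMem_support_iff.1 h, map_zero]

lemma eval_mapFunctional (φ : W →ₗ[ℂ] ℂ) (F : MvPolynomial σ W) (x : σ → ℂ) :
    eval x (mapFunctional φ F) = φ (eval (fun i => algebraMap ℂ W (x i)) F) := by
  conv_rhs => rw [F.as_sum]
  rw [mapFunctional, map_sum, map_sum, map_sum]
  refine Finset.sum_congr rfl fun m _ => ?_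
  rw [eval_monomial, eval_monomial]
  simp only [Finsupp.prod, ← map_pow, ← map_prod]
  rw [mul_comm (coeff m F), ← Algebra.smul_def, map_smul, smul_eq_mul, mul_comm]

end CoefficientFunctional

section UnitaryTopology

variable {N : ℕ}

instance : BorelSpace (UN N) := ⟨rfl⟩

instance : BorelSpace (SUN N) := ⟨rfl⟩

instance : CompactSpace (UN N) := by
  refine isCompact_iff_compactSpace.1 ?_
  have hK : IsCompact (Set.univ.pi fun _ : Fin N => Set.univ.pi fun _ : Fin N =>
      Metric.closedBall (0 : ℂ) 1) :=
    isCompact_univ_pi fun _ => isCompact_univ_pi fun _ => isCompact_closedBall _ _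
  refine hK.of_isClosed_subset ?_ ?_
  · have h : (unitaryGroup (Fin N) ℂ : Set (Matrix (Fin N) (Fin N) ℂ)) =
        {U | star U * U = 1} ∩ {U | U * star U = 1} := by
      ext U
      exact Unitary.mem_iff
    rw [h]
    exact (isClosed_eq (by fun_prop) continuous_const).inter
      (isClosed_eq (by fun_prop) continuous_const)
  · intro U hU i _ j _
    rw [mem_closedBall_zero_iff]
    exact entry_norm_bound_of_unitary hU i j

instance : CompactSpace (SUN N) := by
  refine isCompact_iff_compactSpace.1 (IsClosed.isCompact ?_)
  exact isClosed_eq (f := fun U : UN N => (U : Matrix (Fin N) (Fin N) ℂ).det)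
    (continuous_subtype_val.matrix_det) continuous_const

instance (μ : Measure (UN N)) [μ.IsHaarMeasure] [IsProbabilityMeasure μ] :
    μ.IsMulRightInvariant := by
  refine ⟨fun g => ?_⟩
  have h : IsProbabilityMeasure (μ.map (· * g)) :=
    Measure.isProbabilityMeasure_map (by fun_prop)
  exact Measure.isHaarMeasure_eq_of_isProbabilityMeasure _ _

/-- Integration of continuous functions, as a linear functional. -/
def intFunctional (μ : Measure (UN N)) [IsFiniteMeasure μ] : C(UN N, ℂ) →ₗ[ℂ] ℂ where
  toFun f := ∫ U, f U ∂μ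
  map_add' f g := integral_add
    (f.continuous.integrable_of_hasCompactSupport (HasCompactSupport.of_compactSpace _))
    (g.continuous.integrable_of_hasCompactSupport (HasCompactSupport.of_compactSpace _))
  map_smul' c _ := integral_const_mul c _

/-- The tautological unitary matrix with entries continuous functions on `U(N)`. -/
def tautMat (N : ℕ) : Matrix (Fin N) (Fin N) C(UN N, ℂ) :=
  Matrix.of fun i j => ⟨fun U => (U : Matrix (Fin N) (Fin N) ℂ) i j,
    continuous_subtype_val.matrix_elem i j⟩

/-- Evaluation at a point of `U(N)`. -/
def evalAt (U : UN N) : C(UN N, ℂ) →ₐ[ℂ] ℂ := ContinuousMap.evalAlgHom ℂ ℂ U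

lemma tautMat_map (U : UN N) : (tautMat N).map (evalAt U) = (U : Matrix (Fin N) (Fin N) ℂ) := rfl

/-- The entrywise conjugate transpose of `tautMat`. -/
lemma star_tautMat_map (U : UN N) :
    (star (tautMat N)).map (evalAt U) = star (U : Matrix (Fin N) (Fin N) ℂ) := rfl

end UnitaryTopology

section CompleteHomogeneous

variable {N : ℕ}

/-- The geometric series `1 / (1 - a z)`. -/
def geomSeries (a : ℂ) : PowerSeries ℂ := PowerSeries.mk fun n => a ^ n

lemma geomSeries_mul (a : ℂ) : geomSeries a * (1 - PowerSeries.C a * PowerSeries.X) = 1 := by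
  ext n
  rw [mul_sub, mul_one, map_sub, ← mul_assoc, mul_comm (geomSeries a), mul_assoc,
    PowerSeries.coeff_C_mul]
  cases n with
  | zero => simp [geomSeries]
  | succ n =>
    rw [PowerSeries.coeff_succ_mul_X, PowerSeries.coeff_one]
    simp [geomSeries, pow_succ']

lemma derivative_geomSeries (a : ℂ) : PowerSeries.derivative ℂ (geomSeries a) =
    geomSeries a * (PowerSeries.C a * geomSeries a) := by
  ext n
  rw [PowerSeries.coeff_derivative, PowerSeries.coeff_mul,
    Finset.sum_congr rfl (g := fun _ => a ^ (n + 1)), Finset.sum_const,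
    Finset.Nat.card_antidiagonal]
  · simp [geomSeries, mul_comm]
  · rintro ⟨i, j⟩ hij
    rw [Finset.HasAntidiagonal.mem_antidiagonal] at hij
    rw [PowerSeries.coeff_C_mul]
    simp only [geomSeries, PowerSeries.coeff_mk]
    rw [← hij]
    ring

lemma derivative_prod_geomSeries (x : Fin N → ℂ) (s : Finset (Fin N)) :
    PowerSeries.derivative ℂ (∏ l ∈ s, geomSeries (x l)) =
      (∏ l ∈ s, geomSeries (x l)) * ∑ l ∈ s, PowerSeries.C (x l) * geomSeries (x l) := by
  induction s using Finset.induction_on with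
  | empty => simp
  | insert i s hi ih =>
    rw [Finset.prod_insert hi, Finset.sum_insert hi, Derivation.leibniz, ih,
      derivative_geomSeries, smul_eq_mul, smul_eq_mul]
    ring

lemma hMat_zero (X : Matrix (Fin N) (Fin N) ℂ) : hMat X 0 = 1 := by
  rw [hMat]

lemma hMat_succ (X : Matrix (Fin N) (Fin N) ℂ) (k : ℕ) : hMat X (k + 1) = ((k : ℂ) + 1)⁻¹ *
      ∑ m ∈ Finset.range (k+1), (X ^ (m+1)).trace * hMat X (k - m) := by
  rw [hMat]

lemma hMat_diagonal (x : Fin N → ℂ) (k : ℕ) :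
    hMat (diagonal x) k = PowerSeries.coeff k (∏ l, geomSeries (x l)) := by
  induction k using Nat.strong_induction_on with
  | _ k ih =>
    cases k with
    | zero =>
      rw [hMat_zero, PowerSeries.coeff_zero_eq_constantCoeff_apply, map_prod]
      simp [geomSeries, ← PowerSeries.coeff_zero_eq_constantCoeff_apply]
    | succ k =>
      have h := congrArg (PowerSeries.coeff k) (derivative_prod_geomSeries x Finset.univ)
      rw [PowerSeries.coeff_derivative, mul_comm (∏ l, _), PowerSeries.coeff_mul,
        Finset.Nat.sum_antidiagonal_eq_sum_range_succ_mk] at h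
      have hk : ((k : ℂ) + 1) ≠ 0 := Nat.cast_add_one_ne_zero k
      rw [hMat_succ, inv_mul_eq_iff_eq_mul₀ hk, mul_comm, h]
      refine Finset.sum_congr rfl fun m hm => ?_
      rw [ih _ (by omega), diagonal_pow, trace_diagonal, map_sum]
      congr 1
      refine Finset.sum_congr rfl fun l _ => ?_
      rw [PowerSeries.coeff_C_mul]
      simp [geomSeries, pow_succ']

/-- The complete homogeneous symmetric functions are polynomials in the matrix entries. -/
lemma exists_hPoly (k : ℕ) : ∃ p : MvPolynomial (Fin N × Fin N) ℂ,
    ∀ X : Matrix (Fin N) (Fin N) ℂ, matEval X p = hMat X k := by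
  induction k using Nat.strong_induction_on with
  | _ k ih =>
    cases k with
    | zero => exact ⟨1, fun X => by rw [map_one, hMat_zero]⟩
    | succ k =>
      choose p hp using fun m : ℕ => ih (k - m) (by omega)
      refine ⟨C ((k : ℂ) + 1)⁻¹ * ∑ m ∈ Finset.range (k + 1),
        (genMat N ^ (m + 1)).trace * p m, fun X => ?_⟩
      rw [hMat_succ, map_mul, map_sum]
      congr 1
      · simp [matEval]
      · refine Finset.sum_congr rfl fun m _ => ?_
        rw [map_mul, hp, AddMonoidHom.map_trace (matEval X), ← AlgHom.mapMatrix_apply, map_pow,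
          AlgHom.mapMatrix_apply, genMat_map]

/-- The polynomial in the matrix entries representing `hMat`. -/
def hPoly (N k : ℕ) : MvPolynomial (Fin N × Fin N) ℂ := (exists_hPoly k).choose

lemma matEval_hPoly (k : ℕ) (X : Matrix (Fin N) (Fin N) ℂ) :
    matEval X (hPoly N k) = hMat X k := (exists_hPoly k).choose_spec X

lemma trace_mul_pow_comm (X Y : Matrix (Fin N) (Fin N) ℂ) (m : ℕ) :
    ((X * Y) ^ (m + 1)).trace = ((Y * X) ^ (m + 1)).trace := by
  rw [pow_succ, ← mul_assoc, trace_mul_comm, ← mul_assoc, ← mul_pow_mul, mul_assoc, pow_succ]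

lemma hMat_mul_comm (X Y : Matrix (Fin N) (Fin N) ℂ) (k : ℕ) :
    hMat (X * Y) k = hMat (Y * X) k := by
  induction k using Nat.strong_induction_on with
  | _ k ih =>
    cases k with
    | zero => rw [hMat_zero, hMat_zero]
    | succ k =>
      rw [hMat_succ, hMat_succ]
      congr 1
      refine Finset.sum_congr rfl fun m _ => ?_
      rw [trace_mul_pow_comm, ih _ (by omega)]

/-- The Schur polynomial as a polynomial in the matrix entries. -/
def schurPoly (l : Fin N → ℕ) : MvPolynomial (Fin N × Fin N) ℂ :=
  (Matrix.of fun i j : Fin N => if (l i : ℤ) - (i : ℤ) + (j : ℤ) < 0 then 0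
    else hPoly N ((l i : ℤ) - (i : ℤ) + (j : ℤ)).toNat).det

lemma matEval_schurPoly (l : Fin N → ℕ) (X : Matrix (Fin N) (Fin N) ℂ) :
    matEval X (schurPoly l) = schur l X := by
  rw [schurPoly, schur, AlgHom.map_det]
  congr 1
  ext i j
  simp only [AlgHom.mapMatrix_apply, map_apply, of_apply, hMatZ]
  split_ifs
  · exact map_zero _
  · exact matEval_hPoly _ _

lemma isClassPoly_schurPoly (l : Fin N → ℕ) : IsClassPoly (schurPoly l) :=
  isClassPoly_of_mul_comm fun X Y => by
    simp_rw [matEval_schurPoly, schur, hMatZ, hMat_mul_comm X Y]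

end CompleteHomogeneous

section Bialternant

variable {N : ℕ}

/-- The product of `1 - x_l z` over all `l ≠ k`. -/
def omitProd (x : Fin N → ℂ) (k : Fin N) : Polynomial ℂ :=
  ∏ l ∈ Finset.univ.erase k, (1 - Polynomial.C (x l) * Polynomial.X)

lemma coeff_omitProd_eq_zero (x : Fin N → ℂ) (k : Fin N) {b : ℕ} (hb : N ≤ b) :
    (omitProd x k).coeff b = 0 := by
  refine Polynomial.coeff_eq_zero_of_natDegree_lt (lt_of_le_of_lt
    (Polynomial.natDegree_prod_le _ _) (lt_of_le_of_lt (b := N - 1) ?_ ?_))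
  · refine (Finset.sum_le_sum (g := fun _ => 1) fun l _ => ?_).trans ?_
    · compute_degree
    · simp
  · have := k.2
    omega

lemma prod_geomSeries_mul_omitProd (x : Fin N → ℂ) (k : Fin N) :
    (∏ l, geomSeries (x l)) * (omitProd x k : PowerSeries ℂ) = geomSeries (x k) := by
  have h : (omitProd x k : PowerSeries ℂ) =
      ∏ l ∈ Finset.univ.erase k, (1 - PowerSeries.C (x l) * PowerSeries.X) := by
    rw [omitProd, ← Polynomial.coeToPowerSeries.ringHom_apply, map_prod]
    simp
  rw [h, ← Finset.mul_prod_erase _ _ (Finset.mem_univ k), mul_assoc, ← Finset.prod_mul_distrib,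
    Finset.prod_eq_one fun l _ => geomSeries_mul (x l), mul_one]

lemma hMatZ_natCast_sub (X : Matrix (Fin N) (Fin N) ℂ) {n b : ℕ} (h : b ≤ n) :
    hMatZ X ((n : ℤ) - b) = hMat X (n - b) := by
  rw [hMatZ, if_neg (by omega)]
  congr 1
  omega

lemma sum_hMatZ_mul_coeff (x : Fin N → ℂ) (k : Fin N) (n : ℕ) :
    ∑ b ∈ Finset.range N, hMatZ (diagonal x) ((n : ℤ) - b) * (omitProd x k).coeff b = x k ^ n := by
  have h := congrArg (PowerSeries.coeff n) (prod_geomSeries_mul_omitProd x k)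
  rw [mul_comm, PowerSeries.coeff_mul, Finset.Nat.sum_antidiagonal_eq_sum_range_succ_mk] at h
  simp only [Polynomial.coeff_coe, geomSeries, PowerSeries.coeff_mk] at h
  rw [← h]
  have h1 : ∑ b ∈ Finset.range N, hMatZ (diagonal x) ((n : ℤ) - b) * (omitProd x k).coeff b =
      ∑ b ∈ Finset.range (max N (n + 1)),
        hMatZ (diagonal x) ((n : ℤ) - b) * (omitProd x k).coeff b := by
    refine Finset.sum_subset (Finset.range_mono (le_max_left _ _)) fun b _ hb => ?_
    rw [coeff_omitProd_eq_zero x k (by simpa using hb), mul_zero]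
  rw [h1]
  symm
  refine (Finset.sum_congr rfl fun b hb => ?_).trans
    (Finset.sum_subset (Finset.range_mono (le_max_right N (n + 1))) fun b _ hb => ?_)
  · rw [hMatZ_natCast_sub _ (by simpa [Nat.lt_succ_iff] using hb), hMat_diagonal, mul_comm]
    rfl
  · rw [hMatZ, if_pos (by simp at hb; omega), zero_mul]

/-- The alternant with exponents `l_i + N - 1 - i`. -/
def altPoly (l : Fin N → ℕ) : MvPolynomial (Fin N) ℂ :=
  (Matrix.of fun i k : Fin N => (X k : MvPolynomial (Fin N) ℂ) ^ (l i + (N - 1 - i))).det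

lemma schur_mul_det (l : Fin N → ℕ) (x : Fin N → ℂ) :
    schur l (diagonal x) *
      (Matrix.of fun j k : Fin N => (omitProd x k).coeff (N - 1 - j)).det =
    eval x (altPoly l) := by
  rw [schur, ← det_mul, altPoly, RingHom.map_det]
  congr 1
  ext i k
  rw [Matrix.mul_apply, RingHom.mapMatrix_apply, map_apply, of_apply, map_pow, eval_X,
    ← sum_hMatZ_mul_coeff, ← Finset.sum_range_reflect, Finset.sum_range]
  refine Finset.sum_congr rfl fun j _ => ?_
  rw [of_apply, of_apply]
  congr 2
  have := i.2
  have := j.2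
  omega

lemma schur_zero (X : Matrix (Fin N) (Fin N) ℂ) : schur 0 X = 1 := by
  rw [schur, det_of_isUpperTriangular]
  · simp [hMatZ, hMat_zero]
  · intro i j hij
    have : (j : ℕ) < i := hij
    rw [of_apply, hMatZ, if_pos]
    simp
    omega

/-- The bialternant formula. -/
lemma diagPoly_schurPoly_mul (l : Fin N → ℕ) :
    diagPoly (schurPoly l) * altPoly 0 = altPoly l := by
  refine MvPolynomial.funext fun x => ?_
  rw [map_mul, eval_diagPoly, matEval_schurPoly, ← schur_mul_det l, ← schur_mul_det 0, schur_zero,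
    one_mul]

lemma exists_first_moved {σ : Equiv.Perm (Fin N)} (hσ : σ ≠ 1) :
    ∃ i, (∀ j < i, σ j = j) ∧ i < σ i := by
  have hne : (Finset.univ.filter fun i => σ i ≠ i).Nonempty := by
    by_contra h
    rw [Finset.not_nonempty_iff_eq_empty, Finset.filter_eq_empty_iff] at h
    exact hσ (Equiv.ext fun i => not_not.1 (h (Finset.mem_univ i)))
  obtain ⟨i, hi, hmin⟩ := Finset.exists_min_image _ id hne
  have hfix : ∀ j < i, σ j = j := fun j hj => by
    by_contra h
    exact absurd (hmin j (by simpa using h)) (not_le.2 hj)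
  refine ⟨i, hfix, lt_of_not_ge fun h => ?_⟩
  have hi' : σ i ≠ i := by simpa using hi
  have h2 := hfix (σ i) (lt_of_le_of_ne h hi')
  exact hi' (σ.injective h2)

/-- The exponent vector of the leading monomial of the alternant. -/
def altExp (l : Fin N → ℕ) : Fin N →₀ ℕ :=
  Finsupp.equivFunOnFinite.symm fun i => l i + (N - 1 - i)

lemma supDegree_altPoly {l : Fin N → ℕ} (hl : Antitone l) :
    AddMonoidAlgebra.supDegree toLex (altPoly l) = toLex (altExp l) ∧
      AddMonoidAlgebra.leadingCoeff toLex (altPoly l) = 1 := by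
  have hexp : altPoly l = ∑ σ : Equiv.Perm (Fin N),
      monomial ((altExp l).mapDomain σ.symm) ((Equiv.Perm.sign σ : ℤ) : ℂ) := by
    rw [altPoly, det_apply]
    refine Finset.sum_congr rfl fun σ _ => ?_
    rw [monomial_eq, Finsupp.prod_fintype _ _ fun _ => pow_zero _, Units.smul_def, zsmul_eq_mul]
    simp [altExp, Finsupp.mapDomain_equiv_apply]
  have hdeg : ∀ σ : Equiv.Perm (Fin N), AddMonoidAlgebra.supDegree toLex
      (monomial ((altExp l).mapDomain σ.symm) ((Equiv.Perm.sign σ : ℤ) : ℂ)) =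
      toLex ((altExp l).mapDomain σ.symm) := fun σ => by
    rw [← single_eq_monomial, AddMonoidAlgebra.supDegree_single_ne_zero _ (by simp)]
  have h := AddMonoidAlgebra.supDegree_leadingCoeff_sum_eq (D := toLex)
    (f := fun σ : Equiv.Perm (Fin N) =>
      monomial ((altExp l).mapDomain σ.symm) ((Equiv.Perm.sign σ : ℤ) : ℂ))
    (Finset.mem_univ 1) fun σ _ hσ => by
      rw [hdeg, hdeg]
      obtain ⟨i, hi, hi'⟩ := exists_first_moved hσ
      have := hl hi'.le
      have := (σ i).2
      refine ⟨i, fun j hj => ?_, ?_⟩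
      · simp [Finsupp.mapDomain_equiv_apply, hi j hj]
      · simp [Finsupp.mapDomain_equiv_apply, altExp]
        omega
  rw [hexp, h.1, h.2, hdeg, ← single_eq_monomial,
    AddMonoidAlgebra.leadingCoeff_single toLex.injective]
  constructor
  · congr 1
    ext i
    simp [Finsupp.mapDomain_equiv_apply]
  · simp

/-- A partition as an exponent vector. -/
def partExp (l : Fin N → ℕ) : Lex (Fin N →₀ ℕ) := toLex (Finsupp.equivFunOnFinite.symm l)

lemma supDegree_diagPoly_schurPoly {l : Fin N → ℕ} (hl : Antitone l) :
    AddMonoidAlgebra.supDegree toLex (diagPoly (schurPoly l)) = partExp l ∧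
      diagPoly (schurPoly l) ≠ 0 := by
  have h := diagPoly_schurPoly_mul l
  have hne : ∀ {l : Fin N → ℕ}, Antitone l → altPoly l ≠ 0 := fun hl h0 => by
    have := (supDegree_altPoly hl).2
    rw [h0, AddMonoidAlgebra.leadingCoeff_zero] at this
    exact zero_ne_one this
  have h0 : Antitone (0 : Fin N → ℕ) := antitone_const
  have hs : diagPoly (schurPoly l) ≠ 0 := left_ne_zero_of_mul (h ▸ hne hl)
  refine ⟨?_, hs⟩
  have hmul := AddMonoidAlgebra.supDegree_mul (D := toLex) (p := diagPoly (schurPoly l))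
    (q := altPoly 0) toLex.injective toLex_add (mul_ne_zero
      ((AddMonoidAlgebra.leadingCoeff_eq_zero toLex.injective).not.2 hs)
      ((AddMonoidAlgebra.leadingCoeff_eq_zero toLex.injective).not.2 (hne h0))) hs (hne h0)
  rw [h, (supDegree_altPoly hl).1, (supDegree_altPoly h0).1] at hmul
  refine add_right_cancel (hmul.symm.trans ?_)
  rw [partExp, ← toLex_add]
  congr 1
  ext i
  simp [altExp]

lemma suppIn_diagPoly_schurPoly {l : Fin N → ℕ} (hl : Antitone l) :
    SuppIn (Set.Iic (partExp l)) (diagPoly (schurPoly l)) := fun m hm => by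
  rw [← (supDegree_diagPoly_schurPoly hl).1]
  exact Set.mem_Iic.2 (Finset.le_sup (f := toLex) (mem_support_iff.2 hm))

lemma coeff_diagPoly_schurPoly_ne_zero {l : Fin N → ℕ} (hl : Antitone l) :
    coeff (ofLex (partExp l)) (diagPoly (schurPoly l)) ≠ 0 := by
  obtain ⟨h, hne⟩ := supDegree_diagPoly_schurPoly hl
  obtain ⟨a, ha, hae⟩ := AddMonoidAlgebra.exists_supDegree_mem_support toLex hne
  rw [← h, hae]
  exact mem_support_iff.1 ha

end Bialternant

section SymmetricPower

variable {N : ℕ} {R : Type*} [CommRing R]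

/-- Linear substitution of variables. -/
def linSubst (X : Matrix (Fin N) (Fin N) R) : MvPolynomial (Fin N) R →ₐ[R] MvPolynomial (Fin N) R :=
  aeval fun i => ∑ j, C (X i j) * MvPolynomial.X j

lemma linSubst_mul (X Y : Matrix (Fin N) (Fin N) R) (p : MvPolynomial (Fin N) R) :
    linSubst (X * Y) p = linSubst Y (linSubst X p) := by
  have h : linSubst (X * Y) = (linSubst Y).comp (linSubst X) := by
    refine algHom_ext fun i => ?_
    simp only [linSubst, AlgHom.comp_apply, aeval_X, map_sum, map_mul, algHom_C, algebraMap_eq,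
      Matrix.mul_apply, Finset.sum_mul, Finset.mul_sum, mul_assoc]
    exact Finset.sum_comm
  rw [h, AlgHom.comp_apply]

lemma linSubst_monomial (X : Matrix (Fin N) (Fin N) R) (b : Fin N →₀ ℕ) :
    linSubst X (monomial b 1) = ∏ i, (∑ j, C (X i j) * MvPolynomial.X j) ^ b i := by
  rw [linSubst, aeval_monomial, map_one, one_mul, Finsupp.prod_fintype _ _ fun _ => pow_zero _]

lemma isHomogeneous_linSubst_monomial (X : Matrix (Fin N) (Fin N) R) (b : Fin N →₀ ℕ) :
    (linSubst X (monomial b 1)).IsHomogeneous (∑ i, b i) := by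
  rw [linSubst_monomial]
  have h := IsHomogeneous.prod (R := R) Finset.univ
    (fun i => (∑ j, C (X i j) * MvPolynomial.X j) ^ b i) (fun i => 1 * b i) fun i _ =>
      (IsHomogeneous.sum Finset.univ _ 1 fun j _ => isHomogeneous_C_mul_X (X i j) j).pow (b i)
  simpa using h

/-- The trace of the action on homogeneous polynomials of degree `k`. -/
def symTrace (k : ℕ) (X : Matrix (Fin N) (Fin N) R) : R :=
  ∑ b ∈ Finset.finsuppAntidiag Finset.univ k, coeff b (linSubst X (monomial b 1))

lemma linSubst_monomial_eq_sum (X : Matrix (Fin N) (Fin N) R) {k : ℕ} {b : Fin N →₀ ℕ}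
    (hb : b ∈ Finset.finsuppAntidiag Finset.univ k) :
    linSubst X (monomial b 1) = ∑ c ∈ Finset.finsuppAntidiag Finset.univ k,
      C (coeff c (linSubst X (monomial b 1))) * monomial c 1 := by
  conv_lhs => rw [(linSubst X (monomial b 1)).as_sum]
  simp_rw [C_mul_monomial, mul_one]
  refine Finset.sum_subset (fun c hc => ?_) fun c _ hc => ?_
  · have h := isHomogeneous_linSubst_monomial X b (mem_support_iff.1 hc)
    rw [Finset.mem_finsuppAntidiag] at hb ⊢
    refine ⟨?_, Finset.subset_univ _⟩
    rw [← hb.1, ← h, Finsupp.weight_apply, Finsupp.sum_fintype _ _ (by simp)]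
    simp
  · rw [notMem_support_iff.1 hc, map_zero]

lemma symTrace_mul_comm (k : ℕ) (X Y : Matrix (Fin N) (Fin N) R) :
    symTrace k (X * Y) = symTrace k (Y * X) := by
  have key : ∀ X Y : Matrix (Fin N) (Fin N) R, symTrace k (X * Y) =
      ∑ b ∈ Finset.finsuppAntidiag Finset.univ k, ∑ c ∈ Finset.finsuppAntidiag Finset.univ k,
        coeff c (linSubst X (monomial b 1)) * coeff b (linSubst Y (monomial c 1)) := by
    intro X Y
    refine Finset.sum_congr rfl fun b hb => ?_
    rw [linSubst_mul, linSubst_monomial_eq_sum X hb, map_sum, coeff_sum]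
    refine Finset.sum_congr rfl fun c _ => ?_
    rw [map_mul, algHom_C, algebraMap_eq, coeff_C_mul, ← linSubst_monomial_eq_sum X hb]
  rw [key, key, Finset.sum_comm]
  simp_rw [mul_comm]

lemma map_symTrace {R' : Type*} [CommRing R'] (f : R →+* R') (k : ℕ)
    (X : Matrix (Fin N) (Fin N) R) : f (symTrace k X) = symTrace k (X.map f) := by
  rw [symTrace, symTrace, map_sum]
  refine Finset.sum_congr rfl fun b _ => ?_
  rw [← coeff_map, linSubst_monomial, linSubst_monomial, map_prod]
  simp

lemma symTrace_diagonal (k : ℕ) (x : Fin N → ℂ) :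
    symTrace k (diagonal x) = hMat (diagonal x) k := by
  rw [hMat_diagonal, PowerSeries.coeff_prod, symTrace]
  refine Finset.sum_congr rfl fun b _ => ?_
  rw [linSubst_monomial]
  have h : ∀ i, ∑ j, C (diagonal x i j) * (X j : MvPolynomial (Fin N) ℂ) = C (x i) * X i := by
    intro i
    rw [Finset.sum_eq_single i (fun j _ hj => by rw [diagonal_apply_ne' _ hj]; simp) (by simp)]
    simp
  simp_rw [h, mul_pow, Finset.prod_mul_distrib, ← map_pow, ← map_prod]
  have h2 : ∏ i, (X i : MvPolynomial (Fin N) ℂ) ^ b i = monomial b 1 := by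
    rw [monomial_eq, map_one, one_mul, Finsupp.prod_fintype _ _ fun _ => pow_zero _]
  rw [h2, coeff_C_mul, coeff_monomial, if_pos rfl, mul_one]
  simp [geomSeries]

lemma symTrace_genMat (k : ℕ) : symTrace k (genMat N) = hPoly N k := by
  have h : ∀ X : Matrix (Fin N) (Fin N) ℂ, matEval X (symTrace k (genMat N)) = symTrace k X := by
    intro X
    conv_rhs => rw [← genMat_map X]
    exact map_symTrace (matEval X : _ →+* ℂ) k (genMat N)
  refine IsClassPoly.eq_of_diagonal (isClassPoly_of_mul_comm fun X Y => ?_)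
    (isClassPoly_of_mul_comm fun X Y => ?_) fun d => ?_
  · rw [h, h, symTrace_mul_comm]
  · rw [matEval_hPoly, matEval_hPoly, hMat_mul_comm]
  · rw [h, matEval_hPoly, symTrace_diagonal]

end SymmetricPower

section Span

variable {σ A : Type*} [CommRing A] [Algebra ℂ A]

/-- If all values of a polynomial lie in a subspace, so do all its coefficients. -/
lemma coeff_mem_of_eval_mem {M : Submodule ℂ A} {F : MvPolynomial σ A}
    (h : ∀ x : σ → ℂ, eval (fun i => algebraMap ℂ A (x i)) F ∈ M) (m : σ →₀ ℕ) :
    coeff m F ∈ M := by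
  by_contra hm
  obtain ⟨φ, hφ, hM⟩ := Submodule.exists_le_ker_of_notMem hm
  refine hφ ?_
  rw [← coeff_mapFunctional]
  have h0 : mapFunctional φ F = 0 := MvPolynomial.funext fun x => by
    rw [eval_mapFunctional, map_zero]
    exact hM (h x)
  rw [h0, coeff_zero]

variable {N : ℕ}

omit [Algebra ℂ A] in
lemma coeff_sum_X_mul_C_pow (a : Fin N → A) (b : Fin N →₀ ℕ) :
    coeff b ((∑ i, X i * C (a i)) ^ (∑ i, b i)) =
      (Nat.multinomial Finset.univ b : A) * ∏ i, a i ^ b i := by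
  have hmon : ∀ c : Fin N → ℕ, ∏ i, (X i * C (a i)) ^ c i =
      monomial (Finsupp.equivFunOnFinite.symm c) (∏ i, a i ^ c i) := fun c => by
    rw [monomial_eq, Finsupp.prod_fintype _ _ fun _ => pow_zero _, map_prod,
      ← Finset.prod_mul_distrib]
    refine Finset.prod_congr rfl fun i _ => ?_
    rw [mul_pow, map_pow, mul_comm]
    rfl
  rw [Finset.sum_pow_eq_sum_piAntidiag, coeff_sum,
    Finset.sum_eq_single (b : Fin N → ℕ)]
  · rw [hmon, ← C_eq_coe_nat, coeff_C_mul, coeff_monomial, if_pos (by simp)]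
  · intro c _ hc
    rw [hmon, ← C_eq_coe_nat, coeff_C_mul, coeff_monomial, if_neg, mul_zero]
    rintro rfl
    simp at hc
  · simp

/-- The complete homogeneous polynomial of degree `k` is a linear combination of `k`-th powers of
matrix coefficients. -/
lemma hPoly_mem_span (k : ℕ) : hPoly N k ∈ Submodule.span ℂ (Set.range fun sv :
    (Fin N → ℂ) × (Fin N → ℂ) => (∑ i, C (sv.1 i) * ∑ j, C (sv.2 j) * genMat N i j) ^ k) := by
  set M := Submodule.span ℂ (Set.range fun sv :
    (Fin N → ℂ) × (Fin N → ℂ) => (∑ i, C (sv.1 i) * ∑ j, C (sv.2 j) * genMat N i j) ^ k)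
  rw [← symTrace_genMat]
  refine Submodule.sum_mem _ fun b hb => coeff_mem_of_eval_mem (fun v => ?_) b
  rw [Finset.mem_finsuppAntidiag] at hb
  have hk : ∑ i, b i = k := hb.1
  rw [linSubst_monomial, map_prod]
  have hcoeff := coeff_sum_X_mul_C_pow (fun i => ∑ j, C (v j) * genMat N i j) b
  have hmem : coeff b ((∑ i, X i * C (∑ j, C (v j) * genMat N i j)) ^ (∑ i, b i)) ∈ M := by
    refine coeff_mem_of_eval_mem (fun s => Submodule.subset_span (Set.mem_range.2 ⟨(s, v), ?_⟩)) b
    simp [hk, algebraMap_eq]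
  rw [hcoeff, ← nsmul_eq_mul, ← Nat.cast_smul_eq_nsmul ℂ,
    Submodule.smul_mem_iff _ (Nat.cast_ne_zero.2 (Nat.multinomial_pos _ _).ne')] at hmem
  convert hmem using 2 with i
  simp [algebraMap_eq, mul_comm]

end Span

section Orthogonality

variable {N : ℕ}

/-- Applying a functional to a matrix polynomial with function coefficients gives a matrix
polynomial. -/
lemma exists_matEval_eq {W : Type*} [CommRing W] [Algebra ℂ W] (φ : W →ₗ[ℂ] ℂ)
    (P Q : Matrix (Fin N) (Fin N) W) (p : MvPolynomial (Fin N × Fin N) ℂ) :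
    ∃ q : MvPolynomial (Fin N × Fin N) ℂ, ∀ S : Matrix (Fin N) (Fin N) ℂ,
      matEval S q = φ (matEval (P * S.map (algebraMap ℂ W) * Q) p) := by
  let Z : Matrix (Fin N) (Fin N) (MvPolynomial (Fin N × Fin N) W) :=
    P.map C * Matrix.of (fun i j => X (i, j)) * Q.map C
  refine ⟨mapFunctional φ (matEval Z p), fun S => ?_⟩
  have h1 : ∀ q : MvPolynomial (Fin N × Fin N) ℂ,
      matEval S q = eval (fun ij => S ij.1 ij.2) q := fun q => by
    simp [matEval, aeval_eq_eval]
  rw [h1, eval_mapFunctional]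
  congr 1
  let e : MvPolynomial (Fin N × Fin N) W →ₐ[ℂ] W :=
    (aeval fun ij : Fin N × Fin N => algebraMap ℂ W (S ij.1 ij.2)).restrictScalars ℂ
  have h2 : ∀ F, eval (fun ij : Fin N × Fin N => algebraMap ℂ W (S ij.1 ij.2)) F = e F := fun F =>
    rfl
  rw [h2, map_matEval]
  congr 2
  have h3 : ∀ M : Matrix (Fin N) (Fin N) W, (M.map C).map e = M := fun M => by
    ext i j
    simp [e]
  rw [Matrix.map_mul, Matrix.map_mul, h3, h3]
  congr 2
  ext i j
  simp [e]

/-- Evaluation of `g (diag(t) Y)` for a matrix `Y` with entries in an algebra. -/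
lemma eval_matEval_diagonal_mul {W : Type*} [CommRing W] [Algebra ℂ W] (t : Fin N → ℂ)
    (Y : Matrix (Fin N) (Fin N) W) (g : MvPolynomial (Fin N × Fin N) ℂ) :
    eval (fun i => algebraMap ℂ W (t i)) (matEval
      (diagonal X * Y.map C : Matrix _ _ (MvPolynomial (Fin N) W)) g) =
      matEval ((diagonal t).map (algebraMap ℂ W) * Y) g := by
  let e : MvPolynomial (Fin N) W →ₐ[ℂ] W :=
    (aeval fun i : Fin N => algebraMap ℂ W (t i)).restrictScalars ℂ
  refine (map_matEval e _ g).trans ?_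
  have h1 : (diagonal X : Matrix (Fin N) (Fin N) (MvPolynomial (Fin N) W)).map e =
      (diagonal t).map (algebraMap ℂ W) := by
    ext i j
    simp only [map_apply, diagonal_apply]
    split_ifs <;> simp [e]
  have h2 : (Y.map C).map e = Y := by
    ext i j
    simp [e]
  rw [Matrix.map_mul, h1, h2]

variable (μ : Measure (UN N)) [μ.IsHaarMeasure] [IsProbabilityMeasure μ]

omit [μ.IsHaarMeasure] in
lemma intFunctional_apply (f : C(UN N, ℂ)) : intFunctional μ f = ∫ U, f U ∂μ := rfl

/-- Scalar matrices inside matrices of continuous functions. -/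
def constMat (A : Matrix (Fin N) (Fin N) ℂ) : Matrix (Fin N) (Fin N) C(UN N, ℂ) :=
  A.map (algebraMap ℂ C(UN N, ℂ))

lemma constMat_map (U : UN N) (A : Matrix (Fin N) (Fin N) ℂ) :
    (constMat A).map (evalAt U) = A := rfl

lemma matEval_apply (Z : Matrix (Fin N) (Fin N) C(UN N, ℂ)) (p : MvPolynomial (Fin N × Fin N) ℂ)
    (U : UN N) : (matEval Z p) U = matEval (Z.map (evalAt U)) p :=
  map_matEval (evalAt U) Z p

/-- The product of powers of the diagonal entries. -/
def diagMonomial (a : Fin N →₀ ℕ) : MvPolynomial (Fin N × Fin N) ℂ := ∏ i, X (i, i) ^ a i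

lemma matEval_diagMonomial (a : Fin N →₀ ℕ) (Z : Matrix (Fin N) (Fin N) ℂ) :
    matEval Z (diagMonomial a) = ∏ i, Z i i ^ a i := by
  simp [diagMonomial, matEval_X]

lemma integral_diagMonomial_unitary {a : Fin N →₀ ℕ} {D : Set (Lex (Fin N →₀ ℕ))}
    (hD : IsLowerSet D) (ha : toLex a ∉ D)
    {g : MvPolynomial (Fin N × Fin N) ℂ} (hg : IsClassPoly g) (hs : SuppIn D (diagPoly g))
    (S : UN N) (V : Matrix (Fin N) (Fin N) ℂ) :
    ∫ U : UN N, star (matEval ((S : Matrix (Fin N) (Fin N) ℂ) * (U : Matrix (Fin N) (Fin N) ℂ) * V) (diagMonomial a)) *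
      matEval (U : Matrix (Fin N) (Fin N) ℂ) g ∂μ = 0 := by
  set I := ∫ U : UN N, star (matEval ((S : Matrix (Fin N) (Fin N) ℂ) * (U : Matrix (Fin N) (Fin N) ℂ) * V) (diagMonomial a)) *
      matEval (U : Matrix (Fin N) (Fin N) ℂ) g ∂μ with hI
  let w : C(UN N, ℂ) := star (matEval (constMat S * tautMat N * constMat V) (diagMonomial a))
  let Y : Matrix (Fin N) (Fin N) C(UN N, ℂ) := constMat S * tautMat N * constMat (star S)
  let φ : C(UN N, ℂ) →ₗ[ℂ] ℂ := intFunctional μ ∘ₗ LinearMap.mulLeft ℂ w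
  let q := mapFunctional φ (matEval (diagonal X * Y.map C) g)
  have hq : ∀ t : Fin N → ℂ, (∀ i, ‖t i‖ = 1) → eval t q = (∏ i, t i ^ a i) * I := by
    intro t ht
    have hq1 : eval t q = ∫ U : UN N,
        star (matEval ((S : Matrix (Fin N) (Fin N) ℂ) * (U : Matrix (Fin N) (Fin N) ℂ) * V) (diagMonomial a)) *
        matEval (diagonal t * ((S : Matrix (Fin N) (Fin N) ℂ) * (U : Matrix (Fin N) (Fin N) ℂ) *
          star (S : Matrix (Fin N) (Fin N) ℂ))) g ∂μ := by
      rw [eval_mapFunctional, eval_matEval_diagonal_mul]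
      refine integral_congr_ae (Filter.Eventually.of_forall fun U => ?_)
      change star ((matEval (constMat (S : Matrix (Fin N) (Fin N) ℂ) * tautMat N * constMat V)
        (diagMonomial a)) U) * (matEval (constMat (diagonal t) * Y) g) U = _
      rw [matEval_apply, matEval_apply]
      simp only [Matrix.map_mul, constMat_map, tautMat_map, Y]
    have hstar : ∀ i, t i * star (t i) = 1 := fun i => by
      simp [Complex.mul_conj, Complex.normSq_eq_norm_sq, ht i]
    rw [hq1, hI]
    conv_rhs => rw [← integral_mul_left_eq_self (μ := μ) _ (S⁻¹ * diagUnitary t ht * S)]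
    rw [← integral_const_mul]
    refine integral_congr_ae (Filter.Eventually.of_forall fun U => ?_)
    have h1 : (S : Matrix (Fin N) (Fin N) ℂ) * ((S⁻¹ * diagUnitary t ht * S * U : UN N) :
        Matrix (Fin N) (Fin N) ℂ) * V = diagonal t * ((S : Matrix (Fin N) (Fin N) ℂ) * (U : Matrix (Fin N) (Fin N) ℂ) * V) := by
      change (S : Matrix (Fin N) (Fin N) ℂ) * (star (S : Matrix (Fin N) (Fin N) ℂ) * diagonal t *
        (S : Matrix (Fin N) (Fin N) ℂ) * (U : Matrix (Fin N) (Fin N) ℂ)) * V = _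
      simp only [← mul_assoc, coe_mul_star, one_mul]
    have h2 : matEval ((S⁻¹ * diagUnitary t ht * S * U : UN N) : Matrix (Fin N) (Fin N) ℂ) g =
        matEval (diagonal t * ((S : Matrix (Fin N) (Fin N) ℂ) * (U : Matrix (Fin N) (Fin N) ℂ) *
          star (S : Matrix (Fin N) (Fin N) ℂ))) g := by
      change matEval (star (S : Matrix (Fin N) (Fin N) ℂ) * diagonal t *
        (S : Matrix (Fin N) (Fin N) ℂ) * (U : Matrix (Fin N) (Fin N) ℂ)) g = _
      rw [mul_assoc, mul_assoc, hg.mul_comm]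
      simp only [mul_assoc]
    have h3 : (∏ i, t i ^ a i) * star (∏ i, t i ^ a i) = 1 := by
      rw [star_prod, ← Finset.prod_mul_distrib]
      exact Finset.prod_eq_one fun i _ => by rw [star_pow, ← mul_pow, hstar, one_pow]
    simp only [h1, h2, matEval_diagMonomial, Matrix.diagonal_mul, mul_pow, Finset.prod_mul_distrib,
      star_mul']
    have h4 : ∀ x y z w : ℂ, z * w = 1 → x * y = z * (w * x * y) := fun x y z w h => by
      linear_combination (-x * y) * h
    exact h4 _ _ _ _ h3
  have hzero : q - C I * monomial a 1 = 0 := by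
    refine eq_zero_of_eval_torus fun t ht => ?_
    rw [map_sub, hq t ht, map_mul, eval_C, eval_monomial, Finsupp.prod_fintype _ _
      fun _ => pow_zero _]
    ring
  have hcoeff := congrArg (coeff a) hzero
  rw [coeff_sub, coeff_C_mul, coeff_monomial, if_pos rfl, mul_one, coeff_zero,
    coeff_mapFunctional] at hcoeff
  have h0 : coeff a (matEval (diagonal X * Y.map C : Matrix _ _ (MvPolynomial (Fin N) C(UN N, ℂ)))
      g) = 0 := by
    by_contra h
    exact ha (hg.suppIn hD hs Y a h)
  rwa [h0, map_zero, zero_sub, neg_eq_zero] at hcoeff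

end Orthogonality

section SchurOrthogonality

variable {N : ℕ} (μ : Measure (UN N)) [μ.IsHaarMeasure] [IsProbabilityMeasure μ]

/-- The `L²` pairing of a translate of a matrix polynomial with another matrix polynomial. -/
def translatePairing (Y Z : Matrix (Fin N) (Fin N) ℂ) (g : MvPolynomial (Fin N × Fin N) ℂ) :
    MvPolynomial (Fin N × Fin N) ℂ →ₗ[ℂ] ℂ :=
  intFunctional μ ∘ₗ LinearMap.mulRight ℂ (star (matEval (tautMat N) g)) ∘ₗ
    (matEval (constMat Y * tautMat N * constMat Z)).toLinearMap

omit [μ.IsHaarMeasure] in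
lemma translatePairing_apply (Y Z : Matrix (Fin N) (Fin N) ℂ)
    (g p : MvPolynomial (Fin N × Fin N) ℂ) :
    translatePairing μ Y Z g p = ∫ U : UN N,
      matEval (Y * (U : Matrix (Fin N) (Fin N) ℂ) * Z) p *
        star (matEval (U : Matrix (Fin N) (Fin N) ℂ) g) ∂μ := by
  refine integral_congr_ae (Filter.Eventually.of_forall fun U => ?_)
  change (matEval (constMat Y * tautMat N * constMat Z) p) U * star ((matEval (tautMat N) g) U) = _
  rw [matEval_apply, matEval_apply]
  simp only [Matrix.map_mul, constMat_map, tautMat_map]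

variable {D : Set (Lex (Fin N →₀ ℕ))} {g : MvPolynomial (Fin N × Fin N) ℂ}

lemma translatePairing_diagMonomial {a : Fin N →₀ ℕ} (hD : IsLowerSet D) (ha : toLex a ∉ D)
    (hg : IsClassPoly g) (hs : SuppIn D (diagPoly g)) (S V : Matrix (Fin N) (Fin N) ℂ) :
    translatePairing μ S V g (diagMonomial a) = 0 := by
  obtain ⟨q, hq⟩ := exists_matEval_eq (intFunctional μ ∘ₗ
    LinearMap.mulRight ℂ (star (matEval (tautMat N) g))) 1 (tautMat N * constMat V)
    (diagMonomial a)
  have h : ∀ S, matEval S q = translatePairing μ S V g (diagMonomial a) := fun S => by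
    rw [hq, one_mul, ← mul_assoc]
    rfl
  suffices hq0 : q = 0 by rw [← h, hq0, map_zero]
  refine matEval_eq_zero_of_unitary fun S => ?_
  rw [h, translatePairing_apply]
  have h0 := congrArg star (integral_diagMonomial_unitary μ hD ha hg hs S V)
  rw [star_zero] at h0
  rw [← h0]
  refine Eq.trans ?_ integral_conj
  refine integral_congr_ae (Filter.Eventually.of_forall fun U => ?_)
  simp

lemma translatePairing_prod_hPoly {a : Fin N →₀ ℕ} (hD : IsLowerSet D) (ha : toLex a ∉ D)
    (hg : IsClassPoly g) (hs : SuppIn D (diagPoly g)) (Y Z : Matrix (Fin N) (Fin N) ℂ) :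
    translatePairing μ Y Z g (∏ i, hPoly N (a i)) = 0 := by
  let T : Fin N → Set (MvPolynomial (Fin N × Fin N) ℂ) := fun k =>
    Set.range fun sv : (Fin N → ℂ) × (Fin N → ℂ) =>
      (∑ i, C (sv.1 i) * ∑ j, C (sv.2 j) * genMat N i j) ^ a k
  have hmem : ∀ s : Finset (Fin N), ∏ i ∈ s, hPoly N (a i) ∈ ∏ i ∈ s, Submodule.span ℂ (T i) := by
    intro s
    induction s using Finset.induction_on with
    | empty =>
      rw [Finset.prod_empty, Finset.prod_empty]
      exact Submodule.one_le.1 le_rfl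
    | insert i s hi ih =>
      rw [Finset.prod_insert hi, Finset.prod_insert hi]
      exact Submodule.mul_mem_mul (hPoly_mem_span (a i)) ih
  have h := hmem Finset.univ
  rw [Submodule.prod_span] at h
  refine (Submodule.span_le (p := LinearMap.ker (translatePairing μ Y Z g))).2 ?_ h
  intro x hx
  obtain ⟨f, hf, rfl⟩ := (Set.mem_finsetProd _ _ _).1 hx
  choose sv hsv using fun i => hf (Finset.mem_univ i)
  let S : Matrix (Fin N) (Fin N) ℂ := Matrix.of fun i => (sv i).1
  let V : Matrix (Fin N) (Fin N) ℂ := Matrix.of fun i j => (sv j).2 i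
  rw [SetLike.mem_coe, LinearMap.mem_ker, translatePairing_apply,
    ← translatePairing_diagMonomial μ hD ha hg hs (S * Y) (Z * V), translatePairing_apply]
  refine integral_congr_ae (Filter.Eventually.of_forall fun U => ?_)
  simp only
  congr 1
  rw [matEval_diagMonomial, map_prod]
  refine Finset.prod_congr rfl fun i _ => ?_
  have h1 : S * Y * (U : Matrix (Fin N) (Fin N) ℂ) * (Z * V) =
      S * (Y * (U : Matrix (Fin N) (Fin N) ℂ) * Z * V) := by
    simp only [mul_assoc]
  rw [← hsv i, h1]
  generalize Y * (U : Matrix (Fin N) (Fin N) ℂ) * Z = X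
  rw [map_pow, map_sum, mul_apply]
  congr 1
  refine Finset.sum_congr rfl fun j _ => ?_
  rw [map_mul, map_sum, mul_apply]
  congr 1
  · simp [matEval, S]
  · refine Finset.sum_congr rfl fun k _ => ?_
    rw [map_mul, mul_comm]
    congr 1
    · simp [genMat, matEval_X]
    · simp [matEval, V]

lemma translatePairing_schurPoly {l : Fin N → ℕ}
    (hg : IsClassPoly g) (hs : SuppIn (Set.Iio (partExp l)) (diagPoly g))
    (Y Z : Matrix (Fin N) (Fin N) ℂ) :
    translatePairing μ Y Z g (schurPoly l) = 0 := by
  rw [schurPoly, ← det_transpose, det_apply, map_sum]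
  refine Finset.sum_eq_zero fun σ _ => ?_
  rw [Units.smul_def, map_zsmul]
  convert smul_zero _
  by_cases hneg : ∃ i, (l i : ℤ) - (i : ℤ) + (σ i : ℤ) < 0
  · obtain ⟨i, hi⟩ := hneg
    rw [Finset.prod_eq_zero (Finset.mem_univ i), map_zero]
    simp [hi]
  · push Not at hneg
    let a : Fin N →₀ ℕ := Finsupp.equivFunOnFinite.symm fun i =>
      ((l i : ℤ) - (i : ℤ) + (σ i : ℤ)).toNat
    have ha : toLex a ∉ Set.Iio (partExp l) := by
      rw [Set.mem_Iio, not_lt]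
      by_cases hσ : σ = 1
      · refine le_of_eq (congrArg toLex ?_)
        ext i
        simp [a, hσ]
      · obtain ⟨i, hi, hi'⟩ := exists_first_moved hσ
        refine le_of_lt ⟨i, fun j hj => ?_, ?_⟩
        · simp [partExp, a, hi j hj]
        · have : (i : ℕ) < (σ i : ℕ) := hi'
          simp [partExp, a]
          omega
    have h := translatePairing_prod_hPoly μ (isLowerSet_Iio _) ha hg hs Y Z
    rw [← h]
    congr 1
    refine Finset.prod_congr rfl fun i _ => ?_
    simp [a, not_lt.2 (hneg i)]

end SchurOrthogonality

section UnitaryIntegral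

variable {N : ℕ}

lemma continuous_matEval {T : Type*} [TopologicalSpace T] {f : T → Matrix (Fin N) (Fin N) ℂ}
    (hf : Continuous f) (p : MvPolynomial (Fin N × Fin N) ℂ) :
    Continuous fun t => matEval (f t) p := by
  have h : ∀ t, matEval (f t) p = eval (fun ij => f t ij.1 ij.2) p := fun t => by
    simp [matEval, aeval_eq_eval]
  simp_rw [h]
  exact (continuous_eval p).comp (continuous_pi fun ij => hf.matrix_elem ij.1 ij.2)

lemma continuous_coe_UN : Continuous fun U : UN N => (U : Matrix (Fin N) (Fin N) ℂ) :=
  continuous_subtype_val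

variable (μ : Measure (UN N)) [μ.IsHaarMeasure] [IsProbabilityMeasure μ]

omit [IsProbabilityMeasure μ] in
lemma eq_zero_of_integral_mul_star {r : MvPolynomial (Fin N × Fin N) ℂ}
    (h : ∫ U : UN N, matEval (U : Matrix (Fin N) (Fin N) ℂ) r *
      star (matEval (U : Matrix (Fin N) (Fin N) ℂ) r) ∂μ = 0) : r = 0 := by
  have hc : Continuous fun U : UN N => ‖matEval (U : Matrix (Fin N) (Fin N) ℂ) r‖ ^ 2 :=
    (continuous_matEval continuous_coe_UN r).norm.pow 2
  have h1 : ∫ U : UN N, ‖matEval (U : Matrix (Fin N) (Fin N) ℂ) r‖ ^ 2 ∂μ = 0 := by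
    apply Complex.ofReal_injective
    rw [Complex.ofReal_zero, ← h]
    refine (integral_ofReal (𝕜 := ℂ)).symm.trans ?_
    refine integral_congr_ae (Filter.Eventually.of_forall fun U => ?_)
    simp [Complex.mul_conj, Complex.normSq_eq_norm_sq]
  rw [integral_eq_zero_iff_of_nonneg (fun U => by positivity)
    (hc.integrable_of_hasCompactSupport (HasCompactSupport.of_compactSpace _))] at h1
  replace h1 := (hc.ae_eq_iff_eq μ continuous_zero).1 h1
  refine matEval_eq_zero_of_unitary fun U => ?_
  simpa using congrFun h1 U

/-- The average of `schur l (U S U* B)` is a class polynomial in `S`, with the leading exponent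
bounded by that of the Schur polynomial. -/
lemma exists_average_poly {l : Fin N → ℕ} (hl : Antitone l) (B : Matrix (Fin N) (Fin N) ℂ) :
    ∃ q : MvPolynomial (Fin N × Fin N) ℂ, IsClassPoly q ∧
      SuppIn (Set.Iic (partExp l)) (diagPoly q) ∧ ∀ S : Matrix (Fin N) (Fin N) ℂ,
        matEval S q = ∫ U : UN N, schur l ((U : Matrix (Fin N) (Fin N) ℂ) * S *
          star (U : Matrix (Fin N) (Fin N) ℂ) * B) ∂μ := by
  obtain ⟨q, hq⟩ := exists_matEval_eq (intFunctional μ) (tautMat N) (star (tautMat N) * constMat B)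
    (schurPoly l)
  have hq' : ∀ S : Matrix (Fin N) (Fin N) ℂ, matEval S q =
      ∫ U : UN N, schur l ((U : Matrix (Fin N) (Fin N) ℂ) * S *
        star (U : Matrix (Fin N) (Fin N) ℂ) * B) ∂μ := fun S => by
    rw [hq, intFunctional_apply]
    refine integral_congr_ae (Filter.Eventually.of_forall fun U => ?_)
    change (matEval (tautMat N * constMat S * (star (tautMat N) * constMat B)) (schurPoly l)) U = _
    rw [matEval_apply]
    simp only [← matEval_schurPoly, Matrix.map_mul, constMat_map, tautMat_map, star_tautMat_map, mul_assoc]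
  refine ⟨q, fun V X => ?_, ?_, hq'⟩
  · rw [hq', hq']
    conv_rhs => rw [← integral_mul_right_eq_self (μ := μ) _ V]
    refine integral_congr_ae (Filter.Eventually.of_forall fun U => ?_)
    simp only [Submonoid.coe_mul, star_mul, mul_assoc]
  · let Y : Matrix (Fin N) (Fin N) C(UN N, ℂ) := star (tautMat N) * constMat B * tautMat N
    have hd : diagPoly q =
        mapFunctional (intFunctional μ) (matEval (diagonal X * Y.map C) (schurPoly l)) := by
      refine MvPolynomial.funext fun x => ?_
      rw [eval_diagPoly, hq', eval_mapFunctional, eval_matEval_diagonal_mul, intFunctional_apply]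
      refine integral_congr_ae (Filter.Eventually.of_forall fun U => ?_)
      change _ = (matEval (constMat (diagonal x) * Y) (schurPoly l)) U
      rw [matEval_apply]
      simp only [← matEval_schurPoly, Y, Matrix.map_mul, constMat_map, tautMat_map, star_tautMat_map]
      rw [mul_assoc, mul_assoc, (isClassPoly_schurPoly l).mul_comm]
      simp only [mul_assoc]
    intro m hm
    rw [hd, coeff_mapFunctional] at hm
    refine (isClassPoly_schurPoly l).suppIn (isLowerSet_Iic _) (suppIn_diagPoly_schurPoly hl) Y m
      fun h0 => hm ?_
    rw [h0, map_zero]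

lemma exists_average_eq_smul {l : Fin N → ℕ} (hl : Antitone l) (B : Matrix (Fin N) (Fin N) ℂ) :
    ∃ c : ℂ, ∀ S : Matrix (Fin N) (Fin N) ℂ,
      ∫ U : UN N, schur l ((U : Matrix (Fin N) (Fin N) ℂ) * S *
        star (U : Matrix (Fin N) (Fin N) ℂ) * B) ∂μ = c * schur l S := by
  obtain ⟨q, hqc, hqs, hq⟩ := exists_average_poly μ hl B
  set c := coeff (ofLex (partExp l)) (diagPoly q) /
    coeff (ofLex (partExp l)) (diagPoly (schurPoly l)) with hc
  set r := q - c • schurPoly l with hr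
  have hrc : IsClassPoly r := hqc.sub ((isClassPoly_schurPoly l).smul c)
  have hrd : diagPoly r = diagPoly q - c • diagPoly (schurPoly l) := by
    rw [diagPoly, hr, map_sub, map_smul]
    rfl
  have hrs : SuppIn (Set.Iio (partExp l)) (diagPoly r) := by
    intro m hm
    rw [hrd, coeff_sub, coeff_smul, smul_eq_mul] at hm
    refine Set.mem_Iio.2 (lt_of_le_of_ne ?_ fun hml => ?_)
    · by_cases h : coeff m (diagPoly q) = 0
      · exact Set.mem_Iic.1 (suppIn_diagPoly_schurPoly hl m fun h' => hm (by rw [h, h']; simp))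
      · exact Set.mem_Iic.1 (hqs m h)
    · rw [← hml, ofLex_toLex] at hc
      have := coeff_diagPoly_schurPoly_ne_zero hl
      rw [← hml, ofLex_toLex] at this
      rw [hc, div_mul_cancel₀ _ this, sub_self] at hm
      exact hm rfl
  have horth := translatePairing_schurPoly μ hrc hrs
  have h1 : ∫ W : UN N, matEval (W : Matrix (Fin N) (Fin N) ℂ) q *
      star (matEval (W : Matrix (Fin N) (Fin N) ℂ) r) ∂μ = 0 := by
    simp_rw [hq, ← integral_mul_const]
    rw [integral_integral_swap_of_hasCompactSupport _ (HasCompactSupport.of_compactSpace _)]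
    · refine integral_eq_zero_of_ae (Filter.Eventually.of_forall fun U => ?_)
      have := horth (U : Matrix (Fin N) (Fin N) ℂ) (star (U : Matrix (Fin N) (Fin N) ℂ) * B)
      rw [translatePairing_apply] at this
      rw [Pi.zero_apply, ← this]
      simp only [matEval_schurPoly, mul_assoc]
    · simp_rw [← matEval_schurPoly]
      refine (continuous_matEval ?_ _).mul (continuous_star.comp (continuous_matEval ?_ _))
      · have h1 : Continuous fun x : UN N × UN N => (x.1 : Matrix (Fin N) (Fin N) ℂ) :=
          continuous_coe_UN.comp continuous_fst
        have h2 : Continuous fun x : UN N × UN N => (x.2 : Matrix (Fin N) (Fin N) ℂ) :=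
          continuous_coe_UN.comp continuous_snd
        exact ((h2.mul h1).mul (continuous_star.comp h2)).mul continuous_const
      · exact continuous_coe_UN.comp continuous_fst
  have h2 : ∫ W : UN N, matEval (W : Matrix (Fin N) (Fin N) ℂ) (schurPoly l) *
      star (matEval (W : Matrix (Fin N) (Fin N) ℂ) r) ∂μ = 0 := by
    have := horth 1 1
    rw [translatePairing_apply] at this
    simpa only [one_mul, mul_one] using this
  have hint : ∀ p : MvPolynomial (Fin N × Fin N) ℂ, Integrable (fun W : UN N =>
      matEval (W : Matrix (Fin N) (Fin N) ℂ) p *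
        star (matEval (W : Matrix (Fin N) (Fin N) ℂ) r)) μ := fun p =>
    ((continuous_matEval continuous_coe_UN p).mul (continuous_star.comp
      (continuous_matEval continuous_coe_UN r))).integrable_of_hasCompactSupport
      (HasCompactSupport.of_compactSpace _)
  have h3 : r = 0 := by
    refine eq_zero_of_integral_mul_star μ ?_
    have h4 : ∀ W : UN N, matEval (W : Matrix (Fin N) (Fin N) ℂ) r *
        star (matEval (W : Matrix (Fin N) (Fin N) ℂ) r) =
        matEval (W : Matrix (Fin N) (Fin N) ℂ) q *
          star (matEval (W : Matrix (Fin N) (Fin N) ℂ) r) -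
        c * (matEval (W : Matrix (Fin N) (Fin N) ℂ) (schurPoly l) *
          star (matEval (W : Matrix (Fin N) (Fin N) ℂ) r)) := fun W => by
      have : matEval (W : Matrix (Fin N) (Fin N) ℂ) r = matEval (W : Matrix (Fin N) (Fin N) ℂ) q -
          c * matEval (W : Matrix (Fin N) (Fin N) ℂ) (schurPoly l) := by
        rw [hr, map_sub, map_smul, smul_eq_mul]
      generalize star (matEval (W : Matrix (Fin N) (Fin N) ℂ) r) = z
      rw [this]
      ring
    simp_rw [h4]
    rw [integral_sub (hint q) ((hint _).const_mul c), integral_const_mul, h1, h2, mul_zero,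
      sub_zero]
  refine ⟨c, fun S => ?_⟩
  rw [← hq, sub_eq_zero.1 (hr.symm.trans h3), map_smul, smul_eq_mul, matEval_schurPoly]

lemma integral_schur_unitary {l : Fin N → ℕ} (hl : Antitone l) (A B : Matrix (Fin N) (Fin N) ℂ) :
    ∫ U : UN N, schur l ((U : Matrix (Fin N) (Fin N) ℂ) * A *
        star (U : Matrix (Fin N) (Fin N) ℂ) * B) ∂μ =
      schur l A * schur l B / schur l (1 : Matrix (Fin N) (Fin N) ℂ) := by
  have hone : ∀ B : Matrix (Fin N) (Fin N) ℂ, ∃ c : ℂ, schur l B = c * schur l 1 ∧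
      ∀ S : Matrix (Fin N) (Fin N) ℂ, ∫ U : UN N, schur l ((U : Matrix (Fin N) (Fin N) ℂ) * S *
        star (U : Matrix (Fin N) (Fin N) ℂ) * B) ∂μ = c * schur l S := fun B => by
    obtain ⟨c, hc⟩ := exists_average_eq_smul μ hl B
    refine ⟨c, ?_, hc⟩
    rw [← hc]
    simp only [mul_one, coe_mul_star, one_mul]
    simp
  have hne : schur l (1 : Matrix (Fin N) (Fin N) ℂ) ≠ 0 := fun h0 => by
    have hz : schurPoly l = 0 := matEval_funext fun X => by
      obtain ⟨c, hc, -⟩ := hone X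
      rw [matEval_schurPoly, hc, h0, mul_zero, map_zero]
    have hd : diagPoly (schurPoly l) = 0 := MvPolynomial.funext fun x => by
      rw [eval_diagPoly, hz, map_zero, map_zero]
    exact coeff_diagPoly_schurPoly_ne_zero hl (by rw [hd, coeff_zero])
  obtain ⟨c, hc, h⟩ := hone B
  rw [h, hc]
  field_simp

end UnitaryIntegral

section SpecialUnitary

variable {N : ℕ}

/-- A continuous function on `U(N)` which is invariant under unimodular scalars has the same
average over `SU(N)` and over `U(N)`. -/
lemma integral_SUN_eq_integral_UN (hN : 1 ≤ N)
    (μ : Measure (UN N)) [μ.IsHaarMeasure] [IsProbabilityMeasure μ]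
    (ν : Measure (SUN N)) [ν.IsHaarMeasure] [IsProbabilityMeasure ν]
    {F : UN N → ℂ} (hF : Continuous F)
    (hinv : ∀ (z : ℂ) (hz : ‖z‖ = 1) (U : UN N), F (diagUnitary (fun _ => z) (fun _ => hz) * U) =
      F U) :
    ∫ V : SUN N, F V ∂ν = ∫ U : UN N, F U ∂μ := by
  have htrans : ∀ W : UN N, ∫ V : SUN N, F (W * V) ∂ν = ∫ V : SUN N, F V ∂ν := fun W => by
    have hdet : ‖(W : Matrix (Fin N) (Fin N) ℂ).det‖ = 1 :=
      CStarRing.norm_of_mem_unitary (det_of_mem_unitary W.2)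
    obtain ⟨z, hz⟩ := IsAlgClosed.exists_pow_nat_eq (W : Matrix (Fin N) (Fin N) ℂ).det hN
    have hz1 : ‖z‖ = 1 := by
      rw [← hz, norm_pow] at hdet
      exact (pow_eq_one_iff_of_nonneg (norm_nonneg z) (by omega)).1 hdet
    let Z : UN N := diagUnitary (fun _ => z) fun _ => hz1
    have hZdet : (Z : Matrix (Fin N) (Fin N) ℂ).det = (W : Matrix (Fin N) (Fin N) ℂ).det := by
      rw [← hz]
      change (diagonal fun _ => z).det = _
      simp
    have hW : Z⁻¹ * W ∈ SUN N := by
      change (star (Z : Matrix (Fin N) (Fin N) ℂ) * (W : Matrix (Fin N) (Fin N) ℂ)).det = 1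
      rw [det_mul, ← hZdet, ← det_mul, star_mul_coe, det_one]
    rw [← integral_mul_left_eq_self (μ := ν) (fun V : SUN N => F V) ⟨Z⁻¹ * W, hW⟩]
    refine integral_congr_ae (Filter.Eventually.of_forall fun V => ?_)
    change F (W * V) = F (Z⁻¹ * W * V)
    rw [← hinv z hz1 (Z⁻¹ * W * V)]
    change _ = F (Z * (Z⁻¹ * W * V))
    rw [mul_assoc, mul_inv_cancel_left]
  have h1 : ∫ W : UN N, ∫ V : SUN N, F (W * V) ∂ν ∂μ = ∫ V : SUN N, F V ∂ν := by
    simp_rw [htrans]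
    simp
  rw [← h1, integral_integral_swap_of_hasCompactSupport _ (HasCompactSupport.of_compactSpace _)]
  · simp_rw [integral_mul_right_eq_self (μ := μ) F]
    simp
  · exact hF.comp (continuous_fst.mul (continuous_subtype_val.comp continuous_snd))

end SpecialUnitary

end MatrixPolynomials

/-- `∫_{SU(N)} s_λ(UAU†B) dμ(U) = ∫_{U(N)} s_λ(UAU†B) d_*U
= s_λ(A)s_λ(B)/s_λ(I_N)`. -/
theorem statement7 {N : ℕ} (hN : 1 ≤ N)
    (A B : Matrix (Fin N) (Fin N) ℂ)
    (l : Fin N → ℕ) (hl : Antitone l)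
    (μU : Measure (UN N)) [μU.IsHaarMeasure] [IsProbabilityMeasure μU]
    (μSU : Measure (SUN N)) [μSU.IsHaarMeasure] [IsProbabilityMeasure μSU] :
    (∫ V : SUN N,
        schur l (((V : UN N) : Matrix (Fin N) (Fin N) ℂ) * A * star ((V : UN N) : Matrix (Fin N) (Fin N) ℂ) * B) ∂μSU) =
      (∫ U : UN N,
        schur l ((U : Matrix (Fin N) (Fin N) ℂ) * A * star (U : Matrix (Fin N) (Fin N) ℂ) * B) ∂μU) ∧
    (∫ U : UN N,
        schur l ((U : Matrix (Fin N) (Fin N) ℂ) * A * star (U : Matrix (Fin N) (Fin N) ℂ) * B) ∂μU) =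
      schur l A * schur l B / schur l (1 : Matrix (Fin N) (Fin N) ℂ) := by
  refine ⟨integral_SUN_eq_integral_UN hN μU μSU (F := fun U => schur l
    ((U : Matrix (Fin N) (Fin N) ℂ) * A * star (U : Matrix (Fin N) (Fin N) ℂ) * B)) ?_ ?_,
    integral_schur_unitary μU hl A B⟩
  · simp_rw [← matEval_schurPoly]
    exact continuous_matEval (((continuous_coe_UN.mul continuous_const).mul
      (continuous_star.comp continuous_coe_UN)).mul continuous_const) _
  · intro z hz U
    have hmul : ((diagUnitary (fun _ => z) (fun _ => hz) * U : UN N) :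
        Matrix (Fin N) (Fin N) ℂ) = z • (U : Matrix (Fin N) (Fin N) ℂ) := by
      change (diagonal fun _ => z) * (U : Matrix (Fin N) (Fin N) ℂ) = _
      rw [smul_eq_diagonal_mul]
    have hzz : star z * z = 1 := by
      simp [Complex.conj_mul', hz]
    simp only [hmul, star_smul, smul_mul_assoc, mul_smul_comm, smul_smul, hzz, one_smul]

end
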